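/- There exists a universal constant c > 0 such that for every n ≥ 1 and every pair of increasing continuously differentiable functions f, g : ℝ^n → [−1, 1], one has E_μ[fg] − E_μ[f]·E_μ[g] ≥ c·φ(∑_{i=1}^n E_μ[∂_i f]·E_μ[∂_i g]), where φ(x) = x / log(e/x). -/

import Mathlib

open MeasureTheory ProbabilityTheory Filter Pointwise

noncomputable section

/-- The standard Gaussian measure on `ℝ`. -/
def stdGaussian : Measure ℝ := gaussianReal 0 1

/-- The `n`-fold product of the standard Gaussian measure on `ℝⁿ`. -/
def gaussianPi (n : ℕ) : Measure (Fin n → ℝ) := Measure.pi fun _ => stdGaussian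

/-- Lower Minkowski content of a set `S ⊆ ℝ` w.r.t. the standard Gaussian measure. -/
def minkContent (S : Set ℝ) : ℝ :=
  Filter.liminf
    (fun r : ℝ =>
      ((stdGaussian (S + Set.Icc (-r) r)).toReal - (stdGaussian S).toReal) / r)
    (nhdsWithin 0 (Set.Ioi 0))

/-- The restriction of `A` along the fiber of `x` in the `i`-th direction. -/
def fiber {n : ℕ} (A : Set (Fin n → ℝ)) (i : Fin n) (x : Fin n → ℝ) : Set ℝ :=
  {y : ℝ | Function.update x i y ∈ A}

/-- The geometric influence of coordinate `i` on `A`. -/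
def geomInfluence {n : ℕ} (A : Set (Fin n → ℝ)) (i : Fin n) : ℝ :=
  ∫ x, minkContent (fiber A i x) ∂(gaussianPi n)

/-- A set is increasing if its indicator is nondecreasing in each coordinate. -/
def IncreasingSet {n : ℕ} (A : Set (Fin n → ℝ)) : Prop :=
  ∀ ⦃x y : Fin n → ℝ⦄, x ≤ y → x ∈ A → y ∈ A

end


noncomputable section

/-- The `i`-th partial derivative of `f : ℝⁿ → ℝ` at `x`. -/
def pderiv {n : ℕ} (f : (Fin n → ℝ) → ℝ) (i : Fin n) (x : Fin n → ℝ) : ℝ :=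
  fderiv ℝ f x (Pi.single i 1)

end

section basics

lemma gaussianPi_def (n : ℕ) : gaussianPi n = Measure.pi fun _ => gaussianReal 0 1 := rfl

instance gaussianPi_prob (n : ℕ) : IsProbabilityMeasure (gaussianPi n) := by
  rw [gaussianPi_def]; infer_instance

/-- Rotation invariance in one dimension. -/
lemma gauss_rot_one (s r : ℝ) (h : s ^ 2 + r ^ 2 = 1) :
    MeasurePreserving (fun p : ℝ × ℝ => (s * p.1 + r * p.2, -r * p.1 + s * p.2))
      ((gaussianReal 0 1).prod (gaussianReal 0 1)) ((gaussianReal 0 1).prod (gaussianReal 0 1)) := by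
  obtain ⟨θ, h1, h2⟩ : ∃ θ : ℝ, s = Real.cos θ ∧ r = Real.sin θ := by
    refine ⟨Complex.arg ⟨s, r⟩, ?_, ?_⟩
    · have hn : ‖(⟨s, r⟩ : ℂ)‖ = 1 := by
        rw [Complex.norm_def, Complex.normSq_mk, ← sq, ← sq, h, Real.sqrt_one]
      rw [Complex.cos_arg (by intro h0; rw [h0] at hn; simp at hn), hn]; simp
    · have hn : ‖(⟨s, r⟩ : ℂ)‖ = 1 := by
        rw [Complex.norm_def, Complex.normSq_mk, ← sq, ← sq, h, Real.sqrt_one]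
      rw [Complex.sin_arg, hn]; simp
  refine ⟨by fun_prop, ?_⟩
  have := IsGaussian.map_rotation_eq_self (μ := gaussianReal 0 1) (by simp) θ
  subst h1 h2
  convert this using 2
  ext p <;> simp [ContinuousLinearMap.rotation_apply]

/-- Rotation invariance of the product Gaussian. -/
lemma gauss_rot (n : ℕ) (s r : ℝ) (h : s ^ 2 + r ^ 2 = 1) :
    MeasurePreserving
      (fun p : (Fin n → ℝ) × (Fin n → ℝ) => (s • p.1 + r • p.2, (-r) • p.1 + s • p.2))
      ((gaussianPi n).prod (gaussianPi n)) ((gaussianPi n).prod (gaussianPi n)) := by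
  have e := measurePreserving_arrowProdEquivProdArrow ℝ ℝ (Fin n)
    (fun _ => gaussianReal 0 1) (fun _ => gaussianReal 0 1)
  have p := measurePreserving_pi (fun _ : Fin n => (gaussianReal 0 1).prod (gaussianReal 0 1))
    (fun _ : Fin n => (gaussianReal 0 1).prod (gaussianReal 0 1)) (fun _ => gauss_rot_one s r h)
  have := (e.comp p).comp e.symm
  exact this

/-- The Cameron-Martin weight. -/
noncomputable def cmw {n : ℕ} (m w : Fin n → ℝ) : ℝ :=
  Real.exp (∑ i, m i * w i - (∑ i, m i ^ 2) / 2)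

lemma gauss_shift_density (m : ℝ) :
    (gaussianReal 0 1).withDensity (fun w => ENNReal.ofReal (Real.exp (m * w - m ^ 2 / 2)))
      = gaussianReal m 1 := by
  rw [gaussianReal_of_var_ne_zero _ one_ne_zero, gaussianReal_of_var_ne_zero _ one_ne_zero,
    ← withDensity_mul _ (by fun_prop) (by fun_prop)]
  congr 1
  ext x
  simp only [Pi.mul_apply, gaussianPDF, gaussianPDFReal]
  rw [← ENNReal.ofReal_mul (by positivity), mul_assoc, ← Real.exp_add]
  congr 3
  simp; ring

lemma gaussPi_shift_density {n : ℕ} (m : Fin n → ℝ) :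
    (gaussianPi n).withDensity (fun w => ENNReal.ofReal (cmw m w))
      = Measure.pi (fun i => gaussianReal (m i) 1) := by
  symm
  refine Measure.pi_eq fun s hs => ?_
  rw [withDensity_apply _ (MeasurableSet.univ_pi hs),
    ← lintegral_indicator (MeasurableSet.univ_pi hs)]
  have key : ∀ w : Fin n → ℝ, (Set.univ.pi s).indicator (fun w => ENNReal.ofReal (cmw m w)) w
      = ∏ i, (s i).indicator (fun y => ENNReal.ofReal (Real.exp (m i * y - m i ^ 2 / 2))) (w i) := by
    intro w
    by_cases hw : w ∈ Set.univ.pi s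
    · rw [Set.indicator_of_mem hw]
      have : ∀ i, w i ∈ s i := fun i => hw i (Set.mem_univ i)
      simp only [Set.indicator_of_mem (this _)]
      rw [← ENNReal.ofReal_prod_of_nonneg (fun _ _ => (Real.exp_pos _).le), ← Real.exp_sum, cmw,
        Finset.sum_sub_distrib, Finset.sum_div]
    · rw [Set.indicator_of_notMem hw]
      have : ∃ i, w i ∉ s i := by
        by_contra hc; push Not at hc; exact hw (fun i _ => hc i)
      obtain ⟨i, hi⟩ := this
      symm
      exact Finset.prod_eq_zero (Finset.mem_univ i) (Set.indicator_of_notMem hi _)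
  simp_rw [key]
  have hind : iIndepFun (fun (i : Fin n) (w : Fin n → ℝ) => 
      (s i).indicator (fun y => ENNReal.ofReal (Real.exp (m i * y - m i ^ 2 / 2))) (w i))
      (gaussianPi n) := by
    rw [gaussianPi_def]
    exact iIndepFun_pi (μ := fun _ : Fin n => gaussianReal 0 1) (X := fun i =>
      (s i).indicator (fun y => ENNReal.ofReal (Real.exp (m i * y - m i ^ 2 / 2))))
      (fun i => ((Measurable.indicator (by fun_prop) (hs i))).aemeasurable)
  have hmi : ∀ i, Measurable ((s i).indicator
    (fun y => ENNReal.ofReal (Real.exp (m i * y - m i ^ 2 / 2)))) := fun i =>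
      (Measurable.indicator (by fun_prop) (hs i))
  have h2 := lintegral_prod_eq_prod_lintegral_of_indepFun (μ := gaussianPi n) Finset.univ _ hind
    (fun i => (hmi i).comp (measurable_pi_apply i))
  rw [h2]
  refine Finset.prod_congr rfl fun i _ => ?_
  rw [← gauss_shift_density, withDensity_apply _ (hs i), ← lintegral_indicator (hs i)]
  rw [gaussianPi_def]
  exact (measurePreserving_eval (fun _ : Fin n => gaussianReal 0 1) i).lintegral_comp (hmi i)

/-- Cameron-Martin formula. -/
lemma cameron_martin {n : ℕ} (m : Fin n → ℝ) (G : (Fin n → ℝ) → ℝ) :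
    ∫ z, G (m + z) ∂(gaussianPi n) = ∫ w, cmw m w * G w ∂(gaussianPi n) := by
  have h1 : MeasurePreserving (MeasurableEquiv.addLeft m) (gaussianPi n)
      (Measure.pi (fun i => gaussianReal (m i) 1)) := by
    rw [gaussianPi_def]
    refine measurePreserving_pi (fun _ : Fin n => gaussianReal 0 1) _ (f := fun i y => m i + y) ?_
    intro i
    refine ⟨by fun_prop, ?_⟩
    rw [gaussianReal_map_const_add]; simp
  have := h1.integral_comp' G
  rw [← gaussPi_shift_density, integral_withDensity_eq_integral_toReal_smul] at this
  · simp only [MeasurableEquiv.coe_addLeft] at this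
    rw [this]
    refine integral_congr_ae (ae_of_all _ fun w => ?_)
    simp only [smul_eq_mul]
    rw [ENNReal.toReal_ofReal (show 0 ≤ cmw m w from (Real.exp_pos _).le)]
  · unfold cmw; fun_prop
  · exact ae_of_all _ fun _ => ENNReal.ofReal_lt_top

end basics

section laplace
variable {n : ℕ}

/-- Functions integrable against all exponentials. -/
def ExpInt (φ : (Fin n → ℝ) → ℝ) : Prop :=
  ∀ c : ℝ, Integrable (fun w => φ w * Real.exp (c * ∑ i, |w i|)) (gaussianPi n)

lemma expInt_one : ExpInt (fun _ : Fin n → ℝ => (1 : ℝ)) := by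
  intro c
  have h1 : Integrable (fun y : ℝ => Real.exp (c * |y|)) (gaussianReal 0 1) :=
    integrable_exp_mul_abs (X := id) (integrable_exp_mul_gaussianReal c)
      (integrable_exp_mul_gaussianReal (-c))
  have h2 := Integrable.fintype_prod (ι := Fin n) (𝕜 := ℝ) (μ := fun _ => gaussianReal 0 1)
    (f := fun _ y => Real.exp (c * |y|)) (fun _ => h1)
  refine h2.congr (ae_of_all _ fun w => ?_)
  simp only [one_mul, Finset.mul_sum, Real.exp_sum]

lemma ExpInt.aesm {φ : (Fin n → ℝ) → ℝ} (h : ExpInt φ) :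
    AEStronglyMeasurable φ (gaussianPi n) := by
  have := (h 0).aestronglyMeasurable
  simpa using this

lemma expInt_of_bdd {φ : (Fin n → ℝ) → ℝ} (hc : AEStronglyMeasurable φ (gaussianPi n)) {C : ℝ}
    (hb : ∀ x, |φ x| ≤ C) : ExpInt φ := by
  intro c
  have := expInt_one (n := n) c
  simp only [one_mul] at this
  exact this.bdd_mul hc (ae_of_all _ hb)

lemma ExpInt.mul_coord {φ : (Fin n → ℝ) → ℝ} (h : ExpInt φ) (i : Fin n) :
    ExpInt (fun w => φ w * w i) := by
  intro c
  refine (h (c + 1)).mono ?_ (ae_of_all _ fun w => ?_)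
  · exact (h.aesm.mul (continuous_apply i).aestronglyMeasurable).mul
      (by fun_prop : Continuous fun w : Fin n → ℝ =>
        Real.exp (c * ∑ i, |w i|)).aestronglyMeasurable
  · have h1 : |w i| ≤ Real.exp (∑ i, |w i|) := by
      have := Real.add_one_le_exp (∑ i, |w i|)
      have h3 : |w i| ≤ ∑ i, |w i| :=
        Finset.single_le_sum (f := fun i => |w i|) (fun _ _ => abs_nonneg _) (Finset.mem_univ i)
      linarith
    simp only [Real.norm_eq_abs, abs_mul, Real.abs_exp, add_mul, Real.exp_add, one_mul]
    have := mul_le_mul_of_nonneg_left h1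
      (mul_nonneg (abs_nonneg (φ w)) (Real.exp_pos (c * ∑ i, |w i|)).le)
    linarith

lemma abs_dot_le (x w : Fin n → ℝ) : |∑ i, x i * w i| ≤ ‖x‖ * ∑ i, |w i| := by
  rw [Finset.mul_sum]
  refine (Finset.abs_sum_le_sum_abs _ _).trans (Finset.sum_le_sum fun i _ => ?_)
  rw [abs_mul]
  exact mul_le_mul_of_nonneg_right (norm_le_pi_norm x i) (abs_nonneg _)

lemma ExpInt.aesm_exp {φ : (Fin n → ℝ) → ℝ} (h : ExpInt φ) (x : Fin n → ℝ) :
    AEStronglyMeasurable (fun w => φ w * Real.exp (∑ i, x i * w i)) (gaussianPi n) :=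
  h.aesm.mul (by fun_prop : Continuous fun w : Fin n → ℝ =>
        Real.exp (∑ i, x i * w i)).aestronglyMeasurable

lemma ExpInt.integrable_exp {φ : (Fin n → ℝ) → ℝ} (h : ExpInt φ) (x : Fin n → ℝ) :
    Integrable (fun w => φ w * Real.exp (∑ i, x i * w i)) (gaussianPi n) := by
  refine (h ‖x‖).mono (h.aesm_exp x) (ae_of_all _ fun w => ?_)
  simp only [Real.norm_eq_abs, abs_mul, Real.abs_exp]
  gcongr
  exact (le_abs_self _).trans (abs_dot_le x w)

/-- Laplace transform. -/
noncomputable def lapl (φ : (Fin n → ℝ) → ℝ) (x : Fin n → ℝ) : ℝ :=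
  ∫ w, φ w * Real.exp (∑ i, x i * w i) ∂(gaussianPi n)

/-- The linear functional `x ↦ ∑ i, x i * w i`. -/
noncomputable def dotL (w : Fin n → ℝ) : (Fin n → ℝ) →L[ℝ] ℝ :=
  LinearMap.toContinuousLinearMap
    { toFun := fun x => ∑ i, x i * w i
      map_add' := fun x y => by simp [add_mul, Finset.sum_add_distrib]
      map_smul' := fun c x => by simp [Finset.mul_sum, mul_assoc] }

lemma dotL_apply (w x : Fin n → ℝ) : dotL w x = ∑ i, x i * w i := rfl

lemma dotL_single (w : Fin n → ℝ) (i : Fin n) : dotL w (Pi.single i 1) = w i := by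
  simp [dotL_apply, Pi.single_apply]

/-- `dotL` as a linear map. -/
noncomputable def dotLL : (Fin n → ℝ) →L[ℝ] ((Fin n → ℝ) →L[ℝ] ℝ) :=
  LinearMap.toContinuousLinearMap
    { toFun := fun w => dotL w
      map_add' := fun x y => by ext; simp [dotL_apply, mul_add, Finset.sum_add_distrib]
      map_smul' := fun c x => by ext; simp [dotL_apply, Finset.mul_sum, mul_left_comm] }

lemma dotLL_apply (w : Fin n → ℝ) : dotLL w = dotL w := rfl

lemma dotL_norm_le (w : Fin n → ℝ) : ‖dotL w‖ ≤ ∑ i, |w i| := by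
  refine ContinuousLinearMap.opNorm_le_bound _ (Finset.sum_nonneg fun _ _ => abs_nonneg _) fun x => ?_
  rw [dotL_apply, Real.norm_eq_abs, mul_comm]
  exact abs_dot_le x w

lemma dotL_hasFDerivAt (w x : Fin n → ℝ) :
    HasFDerivAt (fun x : Fin n → ℝ => ∑ i, x i * w i) (dotL w) x := (dotL w).hasFDerivAt

lemma ExpInt.hasFDerivAt {φ : (Fin n → ℝ) → ℝ} (h : ExpInt φ) (x₀ : Fin n → ℝ) :
    HasFDerivAt (lapl φ) (dotL (fun i => lapl (fun w => φ w * w i) x₀)) x₀ := by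
  let v : (Fin n → ℝ) → (Fin n → ℝ) → (Fin n → ℝ) :=
    fun x w i => (φ w * w i) * Real.exp (∑ i, x i * w i)
  let F' : (Fin n → ℝ) → (Fin n → ℝ) → ((Fin n → ℝ) →L[ℝ] ℝ) := fun x w => dotL (v x w)
  have hint : Integrable (fun w => v x₀ w) (gaussianPi n) :=
    Integrable.of_eval fun i => (h.mul_coord i).integrable_exp x₀
  have hint2 : Integrable (F' x₀) (gaussianPi n) := dotLL.integrable_comp hint
  have e : dotL (fun i => lapl (fun w => φ w * w i) x₀) = ∫ w, F' x₀ w ∂(gaussianPi n) := by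
    have := dotLL.integral_comp_comm hint
    simp only [dotLL_apply] at this
    rw [this]
    congr 1
    ext i
    rw [eval_integral (fun i => (h.mul_coord i).integrable_exp x₀)]
    rfl
  rw [e]
  have b1 : ∀ᵐ w ∂(gaussianPi n), ∀ x ∈ Metric.ball x₀ 1, ‖F' x w‖ ≤
      ∑ i, |(φ w * w i) * Real.exp ((‖x₀‖ + 1) * ∑ i, |w i|)| := by
    refine ae_of_all _ fun w x hx => ?_
    refine (dotL_norm_le _).trans (Finset.sum_le_sum fun i _ => ?_)
    simp only [v]
    rw [abs_mul, abs_mul (φ w * w i), Real.abs_exp, Real.abs_exp]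
    have h2 : ‖x‖ ≤ ‖x₀‖ + 1 := by
      have := norm_le_norm_add_norm_sub' x x₀
      rw [mem_ball_iff_norm] at hx
      linarith
    gcongr
    refine (le_abs_self _).trans ((abs_dot_le x w).trans ?_)
    gcongr
  have b2 : Integrable (fun w => ∑ i, |(φ w * w i) * Real.exp ((‖x₀‖ + 1) * ∑ i, |w i|)|)
      (gaussianPi n) := integrable_finsetSum _ (fun i _ => ((h.mul_coord i) _).abs)
  have b3 : ∀ᵐ w ∂(gaussianPi n), ∀ x ∈ Metric.ball x₀ 1,
      HasFDerivAt (fun x => φ w * Real.exp (∑ i, x i * w i)) (F' x w) x := by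
    refine ae_of_all _ fun w x _ => ?_
    have h2 := ((dotL_hasFDerivAt w x).exp).const_mul (φ w)
    refine h2.congr_fderiv ?_
    ext y
    simp only [F', v, dotL_apply, smul_apply, smul_eq_mul, Finset.mul_sum]
    refine Finset.sum_congr rfl fun i _ => ?_
    ring
  exact hasFDerivAt_integral_of_dominated_of_fderiv_le
    (Metric.ball_mem_nhds x₀ one_pos) (Eventually.of_forall fun x => h.aesm_exp x)
    (h.integrable_exp x₀) hint2.aestronglyMeasurable b1 b2 b3

lemma ExpInt.contDiff {φ : (Fin n → ℝ) → ℝ} (h : ExpInt φ) (N : ℕ) :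
    ContDiff ℝ N (lapl φ) := by
  induction N generalizing φ with
  | zero =>
    rw [Nat.cast_zero, contDiff_zero]
    exact continuous_iff_continuousAt.2 fun x => (h.hasFDerivAt x).continuousAt
  | succ N ih =>
    rw [Nat.cast_succ, contDiff_succ_iff_hasFDerivAt]
    refine ⟨_, ?_, h.hasFDerivAt⟩
    exact dotLL.contDiff.comp (contDiff_pi.2 fun i => ih (h.mul_coord i))

lemma integral_cmw (m : Fin n → ℝ) : ∫ w, cmw m w ∂(gaussianPi n) = 1 := by
  have := cameron_martin m (fun _ => 1)
  simpa using this.symm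

/-- Gaussian convolution. -/
noncomputable def gconv (φ : (Fin n → ℝ) → ℝ) (x : Fin n → ℝ) : ℝ :=
  ∫ z, φ (x + z) ∂(gaussianPi n)

lemma gconv_eq (φ : (Fin n → ℝ) → ℝ) (x : Fin n → ℝ) :
    gconv φ x = Real.exp (-(∑ i, x i ^ 2) / 2) * lapl φ x := by
  rw [gconv, cameron_martin, lapl, ← integral_const_mul]
  refine integral_congr_ae (ae_of_all _ fun w => ?_)
  simp only [cmw]
  rw [sub_eq_add_neg, Real.exp_add, neg_div]; ring

lemma gconv_contDiff {φ : (Fin n → ℝ) → ℝ} (h : ExpInt φ) (N : ℕ) : ContDiff ℝ N (gconv φ) := by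
  have : gconv φ = fun x => Real.exp (-(∑ i, x i ^ 2) / 2) * lapl φ x := funext (gconv_eq φ)
  rw [this]
  refine ContDiff.mul ?_ (h.contDiff N)
  refine ContDiff.exp (ContDiff.div_const (ContDiff.neg (ContDiff.sum fun i _ => ?_)) _)
  exact (contDiff_apply ℝ ℝ i).pow 2

lemma gconv_pderiv {φ : (Fin n → ℝ) → ℝ} (h : ExpInt φ) (x : Fin n → ℝ) (i : Fin n) :
    pderiv (gconv φ) i x = ∫ z, φ (x + z) * z i ∂(gaussianPi n) := by
  have h0 : gconv φ = fun x => Real.exp (-(∑ i, x i ^ 2) / 2) * lapl φ x := funext (gconv_eq φ)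
  have h1 : HasFDerivAt (fun x : Fin n → ℝ => -(∑ i, x i ^ 2) / 2) (dotL (fun i => -x i)) x := by
    have : HasFDerivAt (fun x : Fin n → ℝ => ∑ i, x i ^ 2) (dotL (fun i => 2 * x i)) x := by
      have h5 := HasFDerivAt.fun_sum (u := Finset.univ) (x := x) (𝕜 := ℝ)
        (A := fun (i : Fin n) (x : Fin n → ℝ) => x i ^ 2)
        fun i _ => (hasFDerivAt_apply (𝕜 := ℝ) (F' := fun _ : Fin n => ℝ) i x).pow 2
      refine h5.congr_fderiv ?_
      ext v
      simp [dotL_apply, ContinuousLinearMap.sum_apply]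
      refine Finset.sum_congr rfl fun i _ => by ring
    have h2 := (this.neg).mul_const (2⁻¹ : ℝ)
    refine h2.congr_fderiv ?_
    ext v
    simp [dotL_apply, Finset.mul_sum]
    refine Finset.sum_congr rfl fun i _ => by ring
  have h2 : HasFDerivAt (fun x => Real.exp (-(∑ i, x i ^ 2) / 2) * lapl φ x) _ x :=
    h1.exp.mul (h.hasFDerivAt x)
  rw [pderiv, h0]
  rw [HasFDerivAt.fderiv h2]
  have h3 := cameron_martin x (fun w => φ w * (w i - x i))
  simp only [Pi.add_apply, add_sub_cancel_left] at h3
  rw [h3]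
  have i1 := (h.mul_coord i).integrable_exp x
  have i2 := h.integrable_exp x
  have h4 : ∀ w, cmw x w * (φ w * (w i - x i)) =
      Real.exp (-(∑ i, x i ^ 2) / 2) * (φ w * w i * Real.exp (∑ i, x i * w i)
        - x i * (φ w * Real.exp (∑ i, x i * w i))) := by
    intro w
    simp only [cmw]
    rw [sub_eq_add_neg (∑ i, x i * w i), Real.exp_add, neg_div]; ring
  simp_rw [h4]
  rw [integral_const_mul, integral_sub i1 (i2.const_mul _), integral_const_mul]
  simp [lapl, dotL_single]
  ring

end laplace

section ibp
variable {n : ℕ}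

/-- Continuous and bounded by `C`. -/
def BC (h : (Fin n → ℝ) → ℝ) (C : ℝ) : Prop := Continuous h ∧ ∀ x, |h x| ≤ C

/-- `C¹`, with values and partial derivatives bounded by `C`. -/
def Nice (h : (Fin n → ℝ) → ℝ) (C : ℝ) : Prop :=
  ContDiff ℝ 1 h ∧ (∀ x, |h x| ≤ C) ∧ ∀ i x, |pderiv h i x| ≤ C

lemma BC.expInt {h : (Fin n → ℝ) → ℝ} {C : ℝ} (hh : BC h C) : ExpInt h :=
  expInt_of_bdd hh.1.aestronglyMeasurable hh.2

lemma ExpInt.integrable {h : (Fin n → ℝ) → ℝ} (hh : ExpInt h) : Integrable h (gaussianPi n) := by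
  simpa using hh 0

lemma BC.integrable {h : (Fin n → ℝ) → ℝ} {C : ℝ} (hh : BC h C) : Integrable h (gaussianPi n) :=
  hh.expInt.integrable

lemma BC.nonneg {h : (Fin n → ℝ) → ℝ} {C : ℝ} (hh : BC h C) : 0 ≤ C :=
  (abs_nonneg _).trans (hh.2 0)

lemma BC.comp {h : (Fin n → ℝ) → ℝ} {C : ℝ} (hh : BC h C) {m : ℕ}
    {φ : (Fin m → ℝ) → (Fin n → ℝ)}
    (hφ : Continuous φ) : BC (fun x => h (φ x)) C :=
  ⟨hh.1.comp hφ, fun _ => hh.2 _⟩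

lemma BC.mul {h k : (Fin n → ℝ) → ℝ} {C D : ℝ} (hh : BC h C) (hk : BC k D) :
    BC (fun x => h x * k x) (C * D) :=
  ⟨hh.1.mul hk.1, fun x => by
    rw [abs_mul]; exact mul_le_mul (hh.2 x) (hk.2 x) (abs_nonneg _) hh.nonneg⟩

lemma BC.abs_integral_le {h : (Fin n → ℝ) → ℝ} {C : ℝ} (hh : BC h C) :
    |∫ x, h x ∂(gaussianPi n)| ≤ C := by
  have := norm_integral_le_of_norm_le_const (μ := gaussianPi n) (f := h) (C := C)
    (ae_of_all _ fun x => hh.2 x)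
  simpa using this

lemma continuous_pderiv {h : (Fin n → ℝ) → ℝ} (hh : ContDiff ℝ 1 h) (i : Fin n) :
    Continuous (pderiv h i) :=
  (hh.continuous_fderiv one_ne_zero).clm_apply continuous_const

lemma Nice.bc {h : (Fin n → ℝ) → ℝ} {C : ℝ} (hh : Nice h C) : BC h C :=
  ⟨hh.1.continuous, hh.2.1⟩

lemma Nice.bc_pderiv {h : (Fin n → ℝ) → ℝ} {C : ℝ} (hh : Nice h C) (i : Fin n) :
    BC (pderiv h i) C :=
  ⟨continuous_pderiv hh.1 i, hh.2.2 i⟩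

/-- fderiv as a sum of partial derivatives. -/
lemma fderiv_eq_sum (h : (Fin n → ℝ) → ℝ) (x v : Fin n → ℝ) :
    fderiv ℝ h x v = ∑ j, pderiv h j x * v j := by
  have : v = ∑ j, v j • (Pi.single j 1 : Fin n → ℝ) := by
    ext k; simp [Finset.sum_apply, Pi.single_apply]
  conv_lhs => rw [this]
  rw [map_sum]
  refine Finset.sum_congr rfl fun j _ => ?_
  rw [map_smul, smul_eq_mul, mul_comm]; rfl

lemma hasDerivAt_line {h : (Fin n → ℝ) → ℝ} (hh : ContDiff ℝ 1 h) (i : Fin n) (z : Fin n → ℝ)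
    (t : ℝ) : HasDerivAt (fun t : ℝ => h (t • (Pi.single i 1 : Fin n → ℝ) + z))
      (pderiv h i (t • (Pi.single i 1 : Fin n → ℝ) + z)) t := by
  have h1 := (hh.differentiable one_ne_zero (t • (Pi.single i 1 : Fin n → ℝ) + z)).hasFDerivAt
  have h2 : HasDerivAt (fun t : ℝ => t • (Pi.single i 1 : Fin n → ℝ) + z)
      ((1 : ℝ) • (Pi.single i 1 : Fin n → ℝ)) t :=
    ((hasDerivAt_id t).smul_const _).add_const z
  have := h1.comp_hasDerivAt t h2
  rw [one_smul] at this
  exact this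

lemma gconv_line {φ : (Fin n → ℝ) → ℝ} (h : ExpInt φ) (i : Fin n) :
    HasDerivAt (fun t : ℝ => gconv φ (t • (Pi.single i 1 : Fin n → ℝ)))
      (∫ z, φ z * z i ∂(gaussianPi n)) 0 := by
  have := hasDerivAt_line (gconv_contDiff h 1) i 0 0
  simp only [add_zero, zero_smul] at this
  rw [gconv_pderiv h] at this
  simpa using this

/-- Gaussian integration by parts. -/
lemma Nice.ibp {h : (Fin n → ℝ) → ℝ} {C : ℝ} (hh : Nice h C) (i : Fin n) :
    ∫ z, h z * z i ∂(gaussianPi n) = ∫ z, pderiv h i z ∂(gaussianPi n) := by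
  refine (gconv_line hh.bc.expInt i).unique ?_
  have h1 : ∀ᶠ t in nhds (0 : ℝ), AEStronglyMeasurable
      (fun z => h (t • (Pi.single i 1 : Fin n → ℝ) + z)) (gaussianPi n) :=
    Eventually.of_forall fun t =>
      (hh.1.continuous.comp (continuous_const.add continuous_id)).aestronglyMeasurable
  have h2 : Integrable (fun z => h ((0 : ℝ) • (Pi.single i 1 : Fin n → ℝ) + z)) (gaussianPi n) :=
    (hh.bc.comp (continuous_const.add continuous_id)).integrable
  have h3 : AEStronglyMeasurable
      (fun z => pderiv h i ((0 : ℝ) • (Pi.single i 1 : Fin n → ℝ) + z)) (gaussianPi n) :=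
    ((hh.bc_pderiv i).1.comp (continuous_const.add continuous_id)).aestronglyMeasurable
  have h4 := hasDerivAt_integral_of_dominated_loc_of_deriv_le (μ := gaussianPi n)
    (F := fun (t : ℝ) z => h (t • (Pi.single i 1 : Fin n → ℝ) + z))
    (F' := fun (t : ℝ) z => pderiv h i (t • (Pi.single i 1 : Fin n → ℝ) + z))
    (x₀ := 0) (s := Set.univ) (bound := fun _ => C) Filter.univ_mem h1 h2 h3
    (ae_of_all _ fun z t _ => hh.2.2 i _) (integrable_const C)
    (ae_of_all _ fun z t _ => hasDerivAt_line hh.1 i z t)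
  have h5 := h4.2
  simp only [zero_smul, zero_add] at h5
  exact h5

lemma pderiv_nonneg {f : (Fin n → ℝ) → ℝ} (hf : Monotone f) (hc : ContDiff ℝ 1 f)
    (i : Fin n) (x : Fin n → ℝ) : 0 ≤ pderiv f i x := by
  have h1 := hasDerivAt_line hc i x 0
  have h2 : Monotone (fun t : ℝ => f (t • (Pi.single i 1 : Fin n → ℝ) + x)) := by
    intro a b hab
    refine hf ?_
    refine add_le_add_left (smul_le_smul_of_nonneg_right hab ?_) _
    intro k; by_cases h : k = i
    · subst h; simp
    · simp [Pi.single_apply, h]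
  have h3 : 0 ≤ deriv (fun t : ℝ => f (t • (Pi.single i 1 : Fin n → ℝ) + x)) 0 :=
    h2.deriv_nonneg
  rw [h1.deriv] at h3
  simpa using h3

/-- Fatou version of integration by parts for monotone functions. -/
lemma integral_pderiv_le {f : (Fin n → ℝ) → ℝ} {C : ℝ} (hf : Monotone f) (hc : ContDiff ℝ 1 f)
    (hb : ∀ x, |f x| ≤ C) (i : Fin n) :
    ∫ x, pderiv f i x ∂(gaussianPi n) ≤ ∫ x, f x * x i ∂(gaussianPi n) := by
  have hbc : BC f C := ⟨hc.continuous, hb⟩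
  have hl := gconv_line hbc.expInt i
  set e : Fin n → ℝ := Pi.single i 1 with he
  have he0 : 0 ≤ e := by
    intro k; by_cases h : k = i
    · subst h; simp [he]
    · simp [he, Pi.single_apply, h]
  let u : ℕ → ℝ := fun k => 1 / ((k : ℝ) + 1)
  have hu : Tendsto u atTop (nhds 0) := tendsto_one_div_add_atTop_nhds_zero_nat
  have hupos : ∀ k, 0 < u k := fun k => Nat.one_div_pos_of_nat
  have hu' : Tendsto u atTop (nhdsWithin 0 {0}ᶜ) :=
    tendsto_nhdsWithin_iff.2 ⟨hu, Eventually.of_forall fun k => (hupos k).ne'⟩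
  let q : ℕ → (Fin n → ℝ) → ℝ := fun k z => (u k)⁻¹ * (f (u k • e + z) - f z)
  have hq0 : ∀ k z, 0 ≤ q k z := fun k z => by
    refine mul_nonneg (inv_nonneg.2 (hupos k).le) (sub_nonneg.2 (hf ?_))
    exact le_add_of_nonneg_left (smul_nonneg (hupos k).le he0)
  have hqc : ∀ k, Continuous (q k) := fun k =>
    continuous_const.mul ((hc.continuous.comp (continuous_const.add continuous_id)).sub
      hc.continuous)
  have hi1 : ∀ k, Integrable (fun z => f (u k • e + z)) (gaussianPi n) := fun k =>
    (hbc.comp (continuous_const.add continuous_id)).integrable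
  have hqi : ∀ k, Integrable (q k) (gaussianPi n) := fun k =>
    ((hi1 k).sub hbc.integrable).const_mul _
  have hqint : Tendsto (fun k => ∫ z, q k z ∂(gaussianPi n)) atTop
      (nhds (∫ z, f z * z i ∂(gaussianPi n))) := by
    have := (hasDerivAt_iff_tendsto_slope_zero.1 hl).comp hu'
    refine this.congr fun k => ?_
    simp only [Function.comp, zero_add, zero_smul, smul_eq_mul, q]
    rw [integral_const_mul, integral_sub (hi1 k) hbc.integrable]
    simp [gconv]
  have hqlim : ∀ z, Tendsto (fun k => q k z) atTop (nhds (pderiv f i z)) := fun z => by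
    have h1 := hasDerivAt_line hc i z 0
    have := (hasDerivAt_iff_tendsto_slope_zero.1 h1).comp hu'
    simp only [zero_smul, zero_add] at this
    exact this.congr fun k => by simp [q, he]
  have hL0 : 0 ≤ ∫ z, f z * z i ∂(gaussianPi n) :=
    ge_of_tendsto' hqint fun k => integral_nonneg (hq0 k)
  rw [integral_eq_lintegral_of_nonneg_ae (ae_of_all _ (pderiv_nonneg hf hc i))
    (continuous_pderiv hc i).aestronglyMeasurable]
  refine ENNReal.toReal_le_of_le_ofReal hL0 ?_
  calc ∫⁻ a, ENNReal.ofReal (pderiv f i a) ∂(gaussianPi n)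
      = ∫⁻ a, liminf (fun k => ENNReal.ofReal (q k a)) atTop ∂(gaussianPi n) := by
        refine lintegral_congr fun a => ?_
        exact ((ENNReal.tendsto_ofReal (hqlim a)).liminf_eq).symm
    _ ≤ liminf (fun k => ∫⁻ a, ENNReal.ofReal (q k a) ∂(gaussianPi n)) atTop :=
        lintegral_liminf_le fun k => (hqc k).measurable.ennreal_ofReal
    _ = liminf (fun k => ENNReal.ofReal (∫ a, q k a ∂(gaussianPi n))) atTop := by
        congr 1; ext k
        rw [ofReal_integral_eq_lintegral_ofReal (hqi k) (ae_of_all _ (hq0 k))]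
    _ = _ := (ENNReal.tendsto_ofReal hqint).liminf_eq

lemma integral_coord (j : Fin n) : ∫ z, z j ∂(gaussianPi n) = 0 := by
  have h1 := gconv_line (expInt_one (n := n)) j
  have h2 : HasDerivAt (fun t : ℝ => gconv (fun _ : Fin n → ℝ => (1 : ℝ))
      (t • (Pi.single j 1 : Fin n → ℝ))) 0 0 := by
    simp only [gconv]
    exact hasDerivAt_const _ _
  simpa using h1.unique h2

lemma expInt_coord (j : Fin n) : ExpInt (fun z : Fin n → ℝ => z j) := by
  simpa using (expInt_one (n := n)).mul_coord j

lemma integral_coord_mul (i j : Fin n) :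
    ∫ z, z j * z i ∂(gaussianPi n) = if i = j then 1 else 0 := by
  refine (gconv_line (expInt_coord j) i).unique ?_
  have : (fun t : ℝ => gconv (fun z : Fin n → ℝ => z j) (t • (Pi.single i 1 : Fin n → ℝ)))
      = fun t => t * (if i = j then 1 else 0) := by
    ext t
    simp only [gconv, Pi.add_apply]
    rw [integral_add (integrable_const _) (expInt_coord j).integrable, integral_coord]
    simp [Pi.single_apply, eq_comm]
  rw [this]
  simpa using (hasDerivAt_id (0 : ℝ)).mul_const (if i = j then (1 : ℝ) else 0)

/-- Bessel inequality for the first chaos. -/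
lemma bessel {h : (Fin n → ℝ) → ℝ} {C : ℝ} (hh : BC h C) :
    ∑ i, (∫ z, h z * z i ∂(gaussianPi n)) ^ 2 ≤ C ^ 2 := by
  set a : Fin n → ℝ := fun i => ∫ z, h z * z i ∂(gaussianPi n) with ha
  have hi1 : Integrable (fun z => h z * h z) (gaussianPi n) := (hh.mul hh).integrable
  have hi2 : ∀ i, Integrable (fun z => a i * (h z * z i)) (gaussianPi n) := fun i =>
    ((hh.expInt.mul_coord i).integrable).const_mul _
  have hi3 : ∀ i j, Integrable (fun z => a i * a j * (z j * z i)) (gaussianPi n) := fun i j =>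
    (((expInt_coord j).mul_coord i).integrable).const_mul _
  have hi2' : Integrable (fun z => ∑ i, a i * (h z * z i)) (gaussianPi n) :=
    integrable_finsetSum _ fun i _ => hi2 i
  have hi3' : Integrable (fun z => ∑ i, ∑ j, a i * a j * (z j * z i)) (gaussianPi n) :=
    integrable_finsetSum _ fun i _ => integrable_finsetSum _ fun j _ => hi3 i j
  have hi4 : Integrable (fun z => h z * h z - 2 * ∑ i, a i * (h z * z i)) (gaussianPi n) :=
    hi1.sub (hi2'.const_mul 2)
  have key : 0 ≤ ∫ z, (h z - ∑ i, a i * z i) ^ 2 ∂(gaussianPi n) :=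
    integral_nonneg fun z => sq_nonneg _
  have e1 : ∀ z, (h z - ∑ i, a i * z i) ^ 2 =
      h z * h z - 2 * ∑ i, a i * (h z * z i) + ∑ i, ∑ j, a i * a j * (z j * z i) := by
    intro z
    have : ∑ i, ∑ j, a i * a j * (z j * z i) = (∑ i, a i * z i) * (∑ j, a j * z j) := by
      rw [Finset.sum_mul_sum]
      refine Finset.sum_congr rfl fun i _ => Finset.sum_congr rfl fun j _ => by ring
    rw [this]
    have : ∑ i, a i * (h z * z i) = h z * ∑ i, a i * z i := by
      rw [Finset.mul_sum]; refine Finset.sum_congr rfl fun i _ => by ring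
    rw [this]; ring
  simp_rw [e1] at key
  rw [integral_add hi4 hi3', integral_sub hi1 (hi2'.const_mul 2),
    integral_const_mul, integral_finsetSum _ (fun i _ => hi2 i),
    integral_finsetSum _ (fun i _ => integrable_finsetSum _ fun j _ => hi3 i j)] at key
  have e2 : ∀ i, ∫ z, ∑ j, a i * a j * (z j * z i) ∂(gaussianPi n) = a i ^ 2 := by
    intro i
    rw [integral_finsetSum _ (fun j _ => hi3 i j)]
    simp_rw [integral_const_mul, integral_coord_mul]
    simp [sq]
  have e3 : ∀ i, ∫ z, a i * (h z * z i) ∂(gaussianPi n) = a i ^ 2 := by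
    intro i
    rw [integral_const_mul, sq]
  simp_rw [e2, e3] at key
  have e4 : ∫ z, h z * h z ∂(gaussianPi n) ≤ C ^ 2 := by
    have := (abs_le.1 (hh.mul hh).abs_integral_le).2
    rwa [← sq] at this
  linarith

end ibp

section avg
variable {n : ℕ}

/-- Rotation invariance of integrals. -/
lemma rot_integral {s r : ℝ} (h : s ^ 2 + r ^ 2 = 1) {G : (Fin n → ℝ) × (Fin n → ℝ) → ℝ}
    (hG : Continuous G) :
    ∫ p, G p ∂((gaussianPi n).prod (gaussianPi n)) =
      ∫ p, G (s • p.1 + r • p.2, (-r) • p.1 + s • p.2) ∂((gaussianPi n).prod (gaussianPi n)) := by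
  have h1 := gauss_rot n s r h
  conv_lhs => rw [← h1.map_eq]
  rw [integral_map h1.measurable.aemeasurable hG.aestronglyMeasurable]

lemma integrable_prod_bdd {G : (Fin n → ℝ) × (Fin n → ℝ) → ℝ} (hG : Continuous G) {C : ℝ}
    (hb : ∀ p, |G p| ≤ C) : Integrable G ((gaussianPi n).prod (gaussianPi n)) :=
  Integrable.of_bound hG.aestronglyMeasurable C (ae_of_all _ hb)

lemma stat {K : (Fin n → ℝ) → ℝ} {C : ℝ} (hK : BC K C) {a b : ℝ} (h : a ^ 2 + b ^ 2 = 1) :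
    ∫ x, ∫ y, K (a • x + b • y) ∂(gaussianPi n) ∂(gaussianPi n) = ∫ x, K x ∂(gaussianPi n) := by
  have h1 := rot_integral (n := n) h (G := fun p => K p.1) (hK.1.comp continuous_fst)
  have c2 : Continuous (fun p : (Fin n → ℝ) × (Fin n → ℝ) => K (a • p.1 + b • p.2)) :=
    hK.1.comp (by fun_prop)
  have c1 : Continuous (fun p : (Fin n → ℝ) × (Fin n → ℝ) => K p.1) :=
    hK.1.comp continuous_fst
  rw [integral_prod _ (integrable_prod_bdd c1 fun _ => hK.2 _),
    integral_prod _ (integrable_prod_bdd c2 fun _ => hK.2 _)] at h1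
  simp only [integral_const, probReal_univ, one_smul] at h1
  exact h1.symm

lemma stat2 {K : (Fin n → ℝ) → ℝ} {C : ℝ} (hK : BC K C) {a b d : ℝ} (h : a ^ 2 + b ^ 2 = d ^ 2)
    (hd : d ≠ 0) (v : Fin n → ℝ) :
    ∫ x, ∫ y, K (v + (a • x + b • y)) ∂(gaussianPi n) ∂(gaussianPi n)
      = ∫ x, K (v + d • x) ∂(gaussianPi n) := by
  have h1 : (a / d) ^ 2 + (b / d) ^ 2 = 1 := by
    rw [div_pow, div_pow, ← add_div, h, div_self (pow_ne_zero 2 hd)]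
  have h2 : BC (fun x => K (v + d • x)) C := hK.comp (by fun_prop)
  rw [← stat h2 h1]
  refine integral_congr_ae (ae_of_all _ fun x => integral_congr_ae (ae_of_all _ fun y => ?_))
  simp only [smul_add, smul_smul, mul_div_cancel₀ _ hd]

lemma bc_avg {K : (Fin n → ℝ) → ℝ} {C : ℝ} (hK : BC K C) (a b : ℝ) :
    BC (fun z => ∫ y, K (a • z + b • y) ∂(gaussianPi n)) C := by
  refine ⟨?_, fun z => BC.abs_integral_le (hK.comp (by fun_prop))⟩
  refine continuous_of_dominated (bound := fun _ => C) ?_ ?_ (integrable_const C) ?_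
  · intro z; exact (hK.1.comp (by fun_prop)).aestronglyMeasurable
  · intro z; exact ae_of_all _ fun y => hK.2 _
  · exact ae_of_all _ fun y => hK.1.comp (by fun_prop)

/-- The Mehler form. -/
noncomputable def mehler (H K : (Fin n → ℝ) → ℝ) (ρ : ℝ) : ℝ :=
  ∫ p : (Fin n → ℝ) × (Fin n → ℝ), H p.1 * K (ρ • p.1 + Real.sqrt (1 - ρ ^ 2) • p.2)
    ∂((gaussianPi n).prod (gaussianPi n))

lemma zrep {H K : (Fin n → ℝ) → ℝ} {C D : ℝ} (hH : BC H C) (hK : BC K D) {ρ : ℝ}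
    (h0 : 0 ≤ ρ) (h1 : ρ < 1) :
    mehler H K ρ = ∫ z, (∫ x, H (√ρ • z + √(1 - ρ) • x) ∂(gaussianPi n)) *
      (∫ y, K (√ρ • z + √(1 - ρ) • y) ∂(gaussianPi n)) ∂(gaussianPi n) := by
  set σ := √ρ with hσ
  set c := √(1 - ρ) with hc
  set d := √(1 - ρ ^ 2) with hd
  have hσ2 : σ ^ 2 = ρ := Real.sq_sqrt h0
  have hc2 : c ^ 2 = 1 - ρ := Real.sq_sqrt (by linarith)
  have hd2 : d ^ 2 = 1 - ρ ^ 2 := Real.sq_sqrt (by nlinarith)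
  have hd0 : d ≠ 0 := by
    intro h; rw [h] at hd2; nlinarith
  set κ : (Fin n → ℝ) → ℝ := fun z => ∫ y, K (σ • z + c • y) ∂(gaussianPi n) with hκ
  have hκb : BC κ D := bc_avg hK σ c
  have cont1 : Continuous (fun p : (Fin n → ℝ) × (Fin n → ℝ) =>
      H (σ • p.1 + c • p.2) * κ p.1) :=
    (hH.1.comp (by fun_prop)).mul (hκb.1.comp (by fun_prop))
  have bd : ∀ u v : Fin n → ℝ, |H u * κ v| ≤ C * D := fun u v => by
    rw [abs_mul]; exact mul_le_mul (hH.2 _) (hκb.2 _) (abs_nonneg _) hH.nonneg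
  have e1 : ∫ z, (∫ x, H (σ • z + c • x) ∂(gaussianPi n)) * κ z ∂(gaussianPi n) =
      ∫ p : (Fin n → ℝ) × (Fin n → ℝ), H (σ • p.1 + c • p.2) * κ p.1
        ∂((gaussianPi n).prod (gaussianPi n)) := by
    rw [integral_prod _ (integrable_prod_bdd cont1 fun p => bd _ _)]
    simp_rw [integral_mul_const]
  rw [e1, rot_integral (s := σ) (r := -c) (by rw [neg_sq]; linarith) cont1]
  have e2 : ∀ p : (Fin n → ℝ) × (Fin n → ℝ),
      σ • (σ • p.1 + -c • p.2) + c • (- -c • p.1 + σ • p.2) = p.1 := by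
    intro p; ext i
    simp only [Pi.add_apply, Pi.smul_apply, smul_eq_mul]
    have : σ ^ 2 + c ^ 2 = 1 := by linarith
    linear_combination (p.1 i) * this
  simp only [e2]
  have cont2 : Continuous (fun p : (Fin n → ℝ) × (Fin n → ℝ) =>
      H p.1 * κ (σ • p.1 + -c • p.2)) :=
    (hH.1.comp (by fun_prop)).mul (hκb.1.comp (by fun_prop))
  have cont3 : Continuous (fun p : (Fin n → ℝ) × (Fin n → ℝ) =>
      H p.1 * K (ρ • p.1 + d • p.2)) :=
    (hH.1.comp (by fun_prop)).mul (hK.1.comp (by fun_prop))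
  have bd' : ∀ u v : Fin n → ℝ, |H u * K v| ≤ C * D := fun u v => by
    rw [abs_mul]; exact mul_le_mul (hH.2 _) (hK.2 _) (abs_nonneg _) hH.nonneg
  rw [mehler, integral_prod _ (integrable_prod_bdd cont2 fun p => bd _ _),
    integral_prod _ (integrable_prod_bdd cont3 fun p => bd' _ _)]
  refine integral_congr_ae (ae_of_all _ fun x => ?_)
  simp only [integral_const_mul]
  congr 1
  have := stat2 hK (a := -(σ * c)) (b := c) (d := d) (by
    rw [hd2]; linear_combination (c ^ 2) * hσ2 + (1 + ρ) * hc2) hd0 (ρ • x)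
  rw [← this]
  refine integral_congr_ae (ae_of_all _ fun b => ?_)
  simp only [hκ]
  refine integral_congr_ae (ae_of_all _ fun y => ?_)
  simp only
  congr 1
  ext i
  simp only [Pi.add_apply, Pi.smul_apply, smul_eq_mul]
  linear_combination (-x i) * hσ2

lemma mehler_zero {H K : (Fin n → ℝ) → ℝ} {C D : ℝ} (hH : BC H C) (hK : BC K D) :
    mehler H K 0 = (∫ x, H x ∂(gaussianPi n)) * ∫ x, K x ∂(gaussianPi n) := by
  rw [zrep hH hK le_rfl one_pos]
  simp

end avg

section harris

lemma harris_prob {α : Type*} [MeasurableSpace α] [LinearOrder α] (μ : Measure α)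
    [IsProbabilityMeasure μ] {f g : α → ℝ} {C : ℝ} (hf : Measurable f) (hg : Measurable g)
    (hfm : Monotone f) (hgm : Monotone g) (hfb : ∀ x, |f x| ≤ C) (hgb : ∀ x, |g x| ≤ C) :
    (∫ x, f x ∂μ) * (∫ x, g x ∂μ) ≤ ∫ x, f x * g x ∂μ := by
  have if1 : Integrable f μ := Integrable.of_bound hf.aestronglyMeasurable C (ae_of_all _ hfb)
  have ig1 : Integrable g μ := Integrable.of_bound hg.aestronglyMeasurable C (ae_of_all _ hgb)
  have ifg : Integrable (fun x => f x * g x) μ := ig1.bdd_mul hf.aestronglyMeasurable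
    (ae_of_all _ hfb)
  have key : 0 ≤ ∫ x, ∫ y, (f x - f y) * (g x - g y) ∂μ ∂μ := by
    refine integral_nonneg fun x => integral_nonneg fun y => ?_
    rcases le_total x y with h | h
    · exact mul_nonneg_of_nonpos_of_nonpos (sub_nonpos.2 (hfm h)) (sub_nonpos.2 (hgm h))
    · exact mul_nonneg (sub_nonneg.2 (hfm h)) (sub_nonneg.2 (hgm h))
  have e1 : ∀ x, ∫ y, (f x - f y) * (g x - g y) ∂μ =
      f x * g x - f x * (∫ y, g y ∂μ) - (∫ y, f y ∂μ) * g x + ∫ y, f y * g y ∂μ := by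
    intro x
    have : ∀ y, (f x - f y) * (g x - g y) = (f x * g x - f x * g y) - f y * g x + f y * g y :=
      fun y => by ring
    simp_rw [this]
    have i1 : Integrable (fun y => f x * g x - f x * g y) μ :=
      (integrable_const _).sub (ig1.const_mul _)
    have i2 : Integrable (fun y => f x * g x - f x * g y - f y * g x) μ :=
      i1.sub (if1.mul_const _)
    rw [integral_add i2 ifg, integral_sub i1 (if1.mul_const _),
      integral_sub (integrable_const _) (ig1.const_mul _), integral_mul_const]
    simp [integral_const_mul, integral_mul_const]
  simp_rw [e1] at key
  have j1 : Integrable (fun x => f x * g x - f x * (∫ y, g y ∂μ)) μ := ifg.sub (if1.mul_const _)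
  have j2 : Integrable (fun x => f x * g x - f x * (∫ y, g y ∂μ) - (∫ y, f y ∂μ) * g x) μ :=
    j1.sub (ig1.const_mul _)
  rw [integral_add j2 (integrable_const _), integral_sub j1 (ig1.const_mul _),
    integral_sub ifg (if1.mul_const _), integral_const_mul, integral_mul_const] at key
  simp only [integral_const, probReal_univ, one_smul] at key
  linarith

lemma harris : ∀ (n : ℕ) (f g : (Fin n → ℝ) → ℝ) (C : ℝ), Measurable f → Measurable g →
    Monotone f → Monotone g → (∀ x, |f x| ≤ C) → (∀ x, |g x| ≤ C) →
    (∫ x, f x ∂(gaussianPi n)) * (∫ x, g x ∂(gaussianPi n)) ≤ ∫ x, f x * g x ∂(gaussianPi n) := by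
  intro n
  induction n with
  | zero =>
    intro f g C _ _ _ _ _ _
    have e : ∀ h : (Fin 0 → ℝ) → ℝ, h = fun _ => h default := fun h => by
      ext x; rw [Subsingleton.elim x default]
    rw [e f, e g]
    simp
  | succ n ih =>
    intro f g C hf hg hfm hgm hfb hgb
    have mp := (measurePreserving_piFinSuccAbove (fun _ : Fin (n + 1) => gaussianReal 0 1) 0).symm
    have tr : ∀ h : (Fin (n + 1) → ℝ) → ℝ, Measurable h → (∃ D, ∀ x, |h x| ≤ D) →
        ∫ x, h x ∂(gaussianPi (n + 1)) =
          ∫ t, ∫ x, h (Fin.cons t x) ∂(gaussianPi n) ∂(gaussianReal 0 1) := by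
      intro h hh hb
      obtain ⟨D, hb⟩ := hb
      have h1 := mp.integral_comp' h
      rw [gaussianPi_def, ← h1]
      have hm : Measurable (fun p : ℝ × (Fin n → ℝ) =>
          h ((MeasurableEquiv.piFinSuccAbove (fun _ : Fin (n + 1) => ℝ) 0).symm p)) :=
        hh.comp (MeasurableEquiv.measurable _)
      erw [integral_prod _ (Integrable.of_bound hm.aestronglyMeasurable D (ae_of_all _ fun p => hb _))]
      refine integral_congr_ae (ae_of_all _ fun t => ?_)
      refine integral_congr_ae (ae_of_all _ fun x => ?_)
      simp [MeasurableEquiv.piFinSuccAbove]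
      rfl
    have mcons : Measurable (fun p : ℝ × (Fin n → ℝ) => (Fin.cons p.1 p.2 : Fin (n + 1) → ℝ)) := by
      refine measurable_pi_iff.2 fun i => ?_
      refine Fin.cases ?_ (fun j => ?_) i
      · simpa using measurable_fst
      · simp only [Fin.cons_succ]
        exact (measurable_pi_apply j).comp measurable_snd
    have mcons' : ∀ t : ℝ, Measurable (fun x : Fin n → ℝ => (Fin.cons t x : Fin (n + 1) → ℝ)) :=
      fun t => mcons.comp (measurable_const.prodMk measurable_id)
    have mono1 : ∀ t : ℝ, Monotone (fun x : Fin n → ℝ => (Fin.cons t x : Fin (n + 1) → ℝ)) :=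
      fun t x y hxy => Fin.cons_le_cons.2 ⟨le_rfl, hxy⟩
    have mono2 : ∀ x : Fin n → ℝ, Monotone (fun t : ℝ => (Fin.cons t x : Fin (n + 1) → ℝ)) :=
      fun x s t hst => Fin.cons_le_cons.2 ⟨hst, le_rfl⟩
    have int1 : ∀ h : (Fin (n + 1) → ℝ) → ℝ, Measurable h → (∀ D, (∀ x, |h x| ≤ D) →
        ∀ t, Integrable (fun x => h (Fin.cons t x)) (gaussianPi n)) := fun h hh D hD t =>
      Integrable.of_bound (hh.comp (mcons' t)).aestronglyMeasurable D (ae_of_all _ fun x => hD _)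
    have meas : ∀ h : (Fin (n + 1) → ℝ) → ℝ, Measurable h →
        Measurable (fun t => ∫ x, h (Fin.cons t x) ∂(gaussianPi n)) := fun h hh => by
      have : StronglyMeasurable (fun p : ℝ × (Fin n → ℝ) => h (Fin.cons p.1 p.2)) :=
        (hh.comp mcons).stronglyMeasurable
      exact (this.integral_prod_right (ν := gaussianPi n)).measurable
    have bdd : ∀ h : (Fin (n + 1) → ℝ) → ℝ, ∀ D, (∀ x, |h x| ≤ D) → ∀ t,
        |∫ x, h (Fin.cons t x) ∂(gaussianPi n)| ≤ D := fun h D hD t => by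
      have := norm_integral_le_of_norm_le_const (μ := gaussianPi n) (f := fun x => h (Fin.cons t x))
        (C := D) (ae_of_all _ fun x => hD _)
      simpa using this
    have mono : ∀ h : (Fin (n + 1) → ℝ) → ℝ, Measurable h → (∀ x, |h x| ≤ C) → Monotone h →
        Monotone (fun t => ∫ x, h (Fin.cons t x) ∂(gaussianPi n)) := fun h hh hb hm s t hst =>
      integral_mono (int1 h hh C hb s) (int1 h hh C hb t) fun x => hm (mono2 x hst)
    have hfgb : ∀ x, |f x * g x| ≤ C * C := fun x => by
      rw [abs_mul]
      exact mul_le_mul (hfb x) (hgb x) (abs_nonneg _) ((abs_nonneg _).trans (hfb x))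
    rw [tr f hf ⟨C, hfb⟩, tr g hg ⟨C, hgb⟩, tr (fun x => f x * g x) (hf.mul hg) ⟨C * C, hfgb⟩]
    refine (harris_prob (gaussianReal 0 1) (meas f hf) (meas g hg) (mono f hf hfb hfm)
      (mono g hg hgb hgm) (bdd f C hfb) (bdd g C hgb)).trans ?_
    refine integral_mono ?_ ?_ fun t => ?_
    · refine Integrable.of_bound ((meas f hf).mul (meas g hg)).aestronglyMeasurable (C * C)
        (ae_of_all _ fun t => ?_)
      rw [Real.norm_eq_abs, abs_mul]
      exact mul_le_mul (bdd f C hfb t) (bdd g C hgb t) (abs_nonneg _)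
        ((abs_nonneg _).trans (hfb 0))
    · exact Integrable.of_bound (meas _ (hf.mul hg)).aestronglyMeasurable (C * C)
        (ae_of_all _ fun t => bdd _ (C * C) hfgb t)
    · exact ih _ _ C (hf.comp (mcons' t)) (hg.comp (mcons' t)) (hfm.comp (mono1 t))
        (hgm.comp (mono1 t)) (fun _ => hfb _) (fun _ => hgb _)

/-- Conditional form of the Harris inequality. -/
lemma harris_avg {n : ℕ} {f g : (Fin n → ℝ) → ℝ} {C : ℝ} (hf : BC f C) (hg : BC g C)
    (hfm : Monotone f) (hgm : Monotone g) {a b : ℝ} (h : a ^ 2 + b ^ 2 = 1) (hb : 0 ≤ b) :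
    ∫ z, (∫ x, f (a • z + b • x) ∂(gaussianPi n)) * (∫ x, g (a • z + b • x) ∂(gaussianPi n))
      ∂(gaussianPi n) ≤ ∫ x, f x * g x ∂(gaussianPi n) := by
  rw [← stat (hf.mul hg) h]
  refine integral_mono ((bc_avg hf a b).mul (bc_avg hg a b)).integrable
    (bc_avg (hf.mul hg) a b).integrable fun z => ?_
  have hm : Monotone fun x : Fin n → ℝ => a • z + b • x := fun x y hxy =>
    add_le_add_right (smul_le_smul_of_nonneg_left hxy hb) _
  have hc : Continuous fun x : Fin n → ℝ => a • z + b • x := by fun_prop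
  exact harris n _ _ C (hf.1.comp hc).measurable (hg.1.comp hc).measurable (hfm.comp hm)
    (hgm.comp hm) (fun _ => hf.2 _) (fun _ => hg.2 _)

end harris

section smoothing
variable {n : ℕ}

/-- The constant `1/√2`. -/
noncomputable def qq : ℝ := √(1 / 2)

lemma qq_sq : qq ^ 2 = 1 / 2 := Real.sq_sqrt (by norm_num)
lemma qq_nonneg : 0 ≤ qq := Real.sqrt_nonneg _
lemma qq_le_one : qq ≤ 1 := by nlinarith [qq_sq, qq_nonneg]

/-- The smoothing operator. -/
noncomputable def smT (h : (Fin n → ℝ) → ℝ) : (Fin n → ℝ) → ℝ := gconv (fun w => h (qq • w))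

lemma smT_eq (h : (Fin n → ℝ) → ℝ) (x : Fin n → ℝ) :
    smT h x = ∫ z, h (qq • x + qq • z) ∂(gaussianPi n) := by
  simp [smT, gconv, smul_add]

lemma BC.scale {h : (Fin n → ℝ) → ℝ} {C : ℝ} (hh : BC h C) (a : ℝ) :
    BC (fun w => h (a • w)) C := hh.comp (by fun_prop)

lemma smT_pderiv {h : (Fin n → ℝ) → ℝ} {C : ℝ} (hh : BC h C) (i : Fin n) (x : Fin n → ℝ) :
    pderiv (smT h) i x = ∫ z, h (qq • (x + z)) * z i ∂(gaussianPi n) :=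
  gconv_pderiv (hh.scale qq).expInt x i

lemma smT_bessel {h : (Fin n → ℝ) → ℝ} {C : ℝ} (hh : BC h C) (x : Fin n → ℝ) :
    ∑ i, (pderiv (smT h) i x) ^ 2 ≤ C ^ 2 := by
  simp_rw [smT_pderiv hh]
  exact bessel (h := fun z => h (qq • (x + z))) (hh.comp (by fun_prop))

lemma smT_nice {h : (Fin n → ℝ) → ℝ} {C : ℝ} (hh : BC h C) : Nice (smT h) C := by
  refine ⟨gconv_contDiff (hh.scale qq).expInt 1, fun x => ?_, fun i x => ?_⟩
  · rw [smT_eq]; exact BC.abs_integral_le (h := fun z => h (qq • x + qq • z)) (hh.comp (by fun_prop))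
  · refine abs_le_of_sq_le_sq ?_ hh.nonneg
    exact (Finset.single_le_sum (f := fun i => (pderiv (smT h) i x) ^ 2)
      (fun i _ => sq_nonneg _) (Finset.mem_univ i)).trans (smT_bessel hh x)

lemma smT_mono {h : (Fin n → ℝ) → ℝ} {C : ℝ} (hh : BC h C) (hm : Monotone h) :
    Monotone (smT h) := by
  intro x y hxy
  rw [smT_eq, smT_eq]
  refine integral_mono (hh.comp (by fun_prop)).integrable (hh.comp (by fun_prop)).integrable
    fun z => hm ?_
  exact add_le_add_left (smul_le_smul_of_nonneg_left hxy qq_nonneg) _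

lemma smT_integral {h : (Fin n → ℝ) → ℝ} {C : ℝ} (hh : BC h C) :
    ∫ x, smT h x ∂(gaussianPi n) = ∫ x, h x ∂(gaussianPi n) := by
  simp_rw [smT_eq]
  exact stat hh (by rw [qq_sq]; norm_num)

/-- Scaling chain rule. -/
lemma pderiv_affine {h : (Fin n → ℝ) → ℝ} (hh : ContDiff ℝ 1 h) (v : Fin n → ℝ) (a : ℝ)
    (i : Fin n) (z : Fin n → ℝ) :
    pderiv (fun z => h (v + a • z)) i z = a * pderiv h i (v + a • z) := by
  have h1 := (hh.differentiable one_ne_zero (v + a • z)).hasFDerivAt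
  have h2 : HasFDerivAt (fun z : Fin n → ℝ => v + a • z)
      (a • ContinuousLinearMap.id ℝ (Fin n → ℝ)) z :=
    ((hasFDerivAt_id z).const_smul a).const_add v
  have h3 := h1.comp z h2
  have h4 : fderiv ℝ (fun z => h (v + a • z)) z = _ := h3.fderiv
  rw [pderiv, h4]
  simp [pderiv]

lemma Nice.affine {h : (Fin n → ℝ) → ℝ} {C : ℝ} (hh : Nice h C) (v : Fin n → ℝ) (a : ℝ) :
    Nice (fun z => h (v + a • z)) (C + |a| * C) := by
  have hC := hh.bc.nonneg
  have ha : 0 ≤ |a| * C := by positivity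
  refine ⟨hh.1.comp (by fun_prop), fun x => (hh.2.1 _).trans (by linarith), fun i x => ?_⟩
  rw [pderiv_affine hh.1, abs_mul]
  have := mul_le_mul_of_nonneg_left (hh.2.2 i (v + a • x)) (abs_nonneg a)
  linarith

/-- Integration by parts for an affine argument. -/
lemma Nice.ibp_affine {h : (Fin n → ℝ) → ℝ} {C : ℝ} (hh : Nice h C) (v : Fin n → ℝ) (a : ℝ)
    (i : Fin n) : ∫ z, h (v + a • z) * z i ∂(gaussianPi n) =
      a * ∫ z, pderiv h i (v + a • z) ∂(gaussianPi n) := by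
  rw [(hh.affine v a).ibp i]
  simp_rw [pderiv_affine hh.1]
  rw [integral_const_mul]

lemma smT_pderiv_eq {h : (Fin n → ℝ) → ℝ} {C : ℝ} (hh : Nice h C) (i : Fin n) :
    pderiv (smT h) i = fun x => qq * smT (pderiv h i) x := by
  ext x
  rw [smT_pderiv hh.bc, smT_eq]
  simp_rw [smul_add]
  exact hh.ibp_affine _ _ i

lemma Nice.const_mul {h : (Fin n → ℝ) → ℝ} {C a : ℝ} (hh : Nice h C) (ha : |a| ≤ 1) :
    Nice (fun x => a * h x) C := by
  have hC := hh.bc.nonneg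
  refine ⟨contDiff_const.mul hh.1, fun x => ?_, fun i x => ?_⟩
  · rw [abs_mul]
    have := mul_le_mul ha (hh.2.1 x) (abs_nonneg _) zero_le_one
    linarith
  · have : pderiv (fun x => a * h x) i x = a * pderiv h i x := by
      rw [pderiv, fderiv_const_mul (hh.1.differentiable one_ne_zero x)]
      rfl
    rw [this, abs_mul]
    have := mul_le_mul ha (hh.2.2 i x) (abs_nonneg _) zero_le_one
    linarith

lemma smT_pderiv_nice {h : (Fin n → ℝ) → ℝ} {C : ℝ} (hh : Nice h C) (i : Fin n) :
    Nice (pderiv (smT h) i) C := by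
  rw [smT_pderiv_eq hh]
  exact (smT_nice (hh.bc_pderiv i)).const_mul (by rw [abs_of_nonneg qq_nonneg]; exact qq_le_one)

lemma smT_coord {h : (Fin n → ℝ) → ℝ} {C : ℝ} (hh : BC h C) (i : Fin n) :
    ∫ z, smT h z * z i ∂(gaussianPi n) = qq * ∫ z, h z * z i ∂(gaussianPi n) := by
  refine (gconv_line (smT_nice hh).bc.expInt i).unique ?_
  have e : (fun t : ℝ => gconv (smT h) (t • (Pi.single i 1 : Fin n → ℝ))) =
      fun t : ℝ => gconv h ((qq * t) • (Pi.single i 1 : Fin n → ℝ)) := by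
    ext t
    simp only [gconv]
    have h1 := stat2 hh (a := qq) (b := qq) (d := 1) (by rw [qq_sq]; norm_num) one_ne_zero
      ((qq * t) • (Pi.single i 1 : Fin n → ℝ))
    simp only [one_smul] at h1
    rw [← h1]
    simp_rw [smT_eq, smul_add, smul_smul, add_assoc]
  rw [e]
  have h2 := gconv_line hh.expInt i
  have h3 : HasDerivAt (fun t : ℝ => qq * t) qq 0 := by
    simpa using (hasDerivAt_id (0 : ℝ)).const_mul qq
  have h4 : HasDerivAt (fun t : ℝ => gconv h (t • (Pi.single i 1 : Fin n → ℝ)))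
      (∫ z, h z * z i ∂(gaussianPi n)) (qq * 0) := by simpa using h2
  have := h4.comp (0 : ℝ) h3
  rw [mul_comm] at this
  exact this

end smoothing

section lam
variable {n : ℕ}

lemma exp_dot_integral (m : Fin n → ℝ) :
    ∫ w, Real.exp (∑ i, m i * w i) ∂(gaussianPi n) = Real.exp ((∑ i, m i ^ 2) / 2) := by
  have h := integral_cmw m
  simp only [cmw, Real.exp_sub, integral_div] at h
  rw [div_eq_one_iff_eq (Real.exp_pos _).ne'] at h
  exact h

lemma exp_dot_integrable (m : Fin n → ℝ) :
    Integrable (fun w => Real.exp (∑ i, m i * w i)) (gaussianPi n) := by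
  simpa using (expInt_one (n := n)).integrable_exp m

lemma dot_lam {h : (Fin n → ℝ) → ℝ} {C : ℝ} (hh : BC h C) (h0 : ∀ x, 0 ≤ h x) {l : ℝ}
    (hl : 1 ≤ l) (θ : Fin n → ℝ) (hθ : ∑ i, θ i ^ 2 = 1) :
    ∫ z, h z * ∑ i, θ i * z i ∂(gaussianPi n) ≤
      2 * l * (∫ z, h z ∂(gaussianPi n)) +
        Real.exp (-l ^ 2) * √(∫ z, h z ^ 2 ∂(gaussianPi n)) := by
  set y : (Fin n → ℝ) → ℝ := fun z => ∑ i, θ i * z i with hy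
  have hl0 : 0 < l := by linarith
  have ey : ∀ z, Real.exp (l * y z) = Real.exp (∑ i, (l * θ i) * z i) := fun z => by
    simp only [hy, Finset.mul_sum, mul_assoc]
  have ey2 : ∀ z, Real.exp (l * y z) ^ 2 = Real.exp (∑ i, (2 * l * θ i) * z i) := fun z => by
    rw [← Real.exp_nat_mul]
    simp only [hy, Finset.mul_sum]
    congr 1
    refine Finset.sum_congr rfl fun i _ => by push_cast; ring
  have ie : Integrable (fun z => Real.exp (l * y z)) (gaussianPi n) := by
    simp_rw [ey]; exact exp_dot_integrable _
  have ie2 : Integrable (fun z => Real.exp (l * y z) ^ 2) (gaussianPi n) := by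
    simp_rw [ey2]; exact exp_dot_integrable _
  have ve2 : ∫ z, Real.exp (l * y z) ^ 2 ∂(gaussianPi n) = Real.exp (l ^ 2) ^ 2 := by
    simp_rw [ey2]
    rw [exp_dot_integral, ← Real.exp_nat_mul]
    congr 1
    simp_rw [mul_pow, ← Finset.mul_sum, hθ]
    push_cast; ring
  have ihe : Integrable (fun z => h z * Real.exp (l * y z)) (gaussianPi n) :=
    ie.bdd_mul hh.1.aestronglyMeasurable (ae_of_all _ hh.2)
  have ihy : Integrable (fun z => h z * y z) (gaussianPi n) := by
    have : (fun z => h z * y z) = fun z => ∑ i, θ i * (h z * z i) := by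
      ext z; simp only [hy, Finset.mul_sum]
      exact Finset.sum_congr rfl fun i _ => by ring
    rw [this]
    exact integrable_finsetSum _ fun i _ => ((hh.expInt.mul_coord i).integrable).const_mul _
  have m1 : MemLp h (ENNReal.ofReal 2) (gaussianPi n) :=
    MemLp.of_bound hh.1.aestronglyMeasurable C (ae_of_all _ hh.2)
  have m2 : MemLp (fun z => Real.exp (l * y z)) (ENNReal.ofReal 2) (gaussianPi n) := by
    have : ENNReal.ofReal 2 = 2 := by norm_num
    rw [this]
    exact (memLp_two_iff_integrable_sq ie.aestronglyMeasurable).2 ie2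
  have cs := integral_mul_le_Lp_mul_Lq_of_nonneg (μ := gaussianPi n) (p := 2) (q := 2)
    (Real.HolderConjugate.two_two) (ae_of_all _ h0)
    (ae_of_all _ fun z => (Real.exp_pos (l * y z)).le) m1 m2
  simp only [Real.rpow_two] at cs
  rw [← Real.sqrt_eq_rpow, ← Real.sqrt_eq_rpow, ve2, Real.sqrt_sq (Real.exp_pos _).le] at cs
  set A := √(∫ z, h z ^ 2 ∂(gaussianPi n))
  have step : l * ∫ z, h z * y z ∂(gaussianPi n) ≤
      2 * l ^ 2 * (∫ z, h z ∂(gaussianPi n)) +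
        Real.exp (-(2 * l ^ 2)) * ∫ z, h z * Real.exp (l * y z) ∂(gaussianPi n) := by
    rw [← integral_const_mul, ← integral_const_mul, ← integral_const_mul,
      ← integral_add (hh.integrable.const_mul _) (ihe.const_mul _)]
    refine integral_mono (ihy.const_mul _) ((hh.integrable.const_mul _).add (ihe.const_mul _))
      fun z => ?_
    have e : Real.exp (-(2 * l ^ 2)) * (h z * Real.exp (l * y z)) =
        h z * Real.exp (l * y z - 2 * l ^ 2) := by
      rw [sub_eq_neg_add, Real.exp_add]; ring
    simp only [e]
    have := Real.add_one_le_exp (l * y z - 2 * l ^ 2)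
    nlinarith [mul_le_mul_of_nonneg_left this (h0 z), h0 z]
  have e2 : Real.exp (-(2 * l ^ 2)) * (A * Real.exp (l ^ 2)) = Real.exp (-l ^ 2) * A := by
    have : Real.exp (-(2 * l ^ 2)) * Real.exp (l ^ 2) = Real.exp (-l ^ 2) := by
      rw [← Real.exp_add]; congr 1; ring
    rw [← this]; ring
  have e3 := mul_le_mul_of_nonneg_left cs (Real.exp_pos (-(2 * l ^ 2))).le
  rw [e2] at e3
  have e4 : Real.exp (-l ^ 2) * A ≤ l * (Real.exp (-l ^ 2) * A) := by
    have : 0 ≤ Real.exp (-l ^ 2) * A := mul_nonneg (Real.exp_pos _).le (Real.sqrt_nonneg _)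
    nlinarith
  refine le_of_mul_le_mul_left ?_ hl0
  nlinarith

lemma vec_lam {h : (Fin n → ℝ) → ℝ} {C : ℝ} (hh : BC h C) (h0 : ∀ x, 0 ≤ h x) {l : ℝ}
    (hl : 1 ≤ l) :
    √(∑ i, (∫ z, h z * z i ∂(gaussianPi n)) ^ 2) ≤
      2 * l * (∫ z, h z ∂(gaussianPi n)) +
        Real.exp (-l ^ 2) * √(∫ z, h z ^ 2 ∂(gaussianPi n)) := by
  set a : Fin n → ℝ := fun i => ∫ z, h z * z i ∂(gaussianPi n) with ha
  have hI : 0 ≤ ∫ z, h z ∂(gaussianPi n) := integral_nonneg h0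
  set N := √(∑ i, a i ^ 2) with hN
  have hS : 0 ≤ ∑ i, a i ^ 2 := Finset.sum_nonneg fun i _ => sq_nonneg _
  have hN2 : N ^ 2 = ∑ i, a i ^ 2 := Real.sq_sqrt hS
  rcases (Real.sqrt_nonneg (∑ i, a i ^ 2)).eq_or_lt with h1 | h1
  · change N ≤ _
    rw [hN, ← h1]; positivity
  · have := dot_lam hh h0 hl (fun i => a i / N) (by
      simp_rw [div_pow, ← Finset.sum_div, ← hN2]
      exact div_self (pow_ne_zero 2 h1.ne'))
    refine le_trans (le_of_eq ?_) this
    have e : ∀ z, h z * ∑ i, a i / N * z i = ∑ i, a i / N * (h z * z i) := fun z => by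
      rw [Finset.mul_sum]; exact Finset.sum_congr rfl fun i _ => by ring
    simp_rw [e]
    rw [integral_finsetSum _ fun i _ => ((hh.expInt.mul_coord i).integrable).const_mul _]
    simp_rw [integral_const_mul]
    have : ∑ i, a i / N * a i = N := by
      have : ∑ i, a i / N * a i = (∑ i, a i ^ 2) / N := by
        rw [Finset.sum_div]; exact Finset.sum_congr rfl fun i _ => by ring
      rw [this, ← hN2, sq, mul_div_assoc, div_self h1.ne', mul_one]
    exact this.symm

end lam

section interp
variable {n : ℕ}

lemma sqrt_hasDerivAt {ρ : ℝ} (h : ρ ∈ Set.Ioo (-(3 / 4) : ℝ) (3 / 4)) :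
    HasDerivAt (fun ρ : ℝ => √(1 - ρ ^ 2)) (-ρ / √(1 - ρ ^ 2)) ρ := by
  have h1 : (1 - ρ ^ 2) ≠ 0 := by nlinarith [h.1, h.2]
  have h2 : HasDerivAt (fun ρ : ℝ => 1 - ρ ^ 2) (-(2 * ρ)) ρ := by
    have := (hasDerivAt_pow 2 ρ).const_sub 1
    simpa using this
  have h3 := h2.sqrt h1
  refine h3.congr_deriv ?_
  rw [neg_div, neg_div, mul_div_mul_left _ _ two_ne_zero]

lemma sqrt_ge_half {ρ : ℝ} (h : ρ ∈ Set.Ioo (-(3 / 4) : ℝ) (3 / 4)) : 1 / 2 ≤ √(1 - ρ ^ 2) := by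
  apply Real.le_sqrt_of_sq_le
  nlinarith [h.1, h.2]

lemma integrable_coord_fst (j : Fin n) : Integrable
    (fun p : (Fin n → ℝ) × (Fin n → ℝ) => |p.1 j|) ((gaussianPi n).prod (gaussianPi n)) :=
  ((expInt_coord j).integrable.abs).comp_fst _

lemma integrable_coord_snd (j : Fin n) : Integrable
    (fun p : (Fin n → ℝ) × (Fin n → ℝ) => |p.2 j|) ((gaussianPi n).prod (gaussianPi n)) :=
  ((expInt_coord j).integrable.abs).comp_snd _

lemma rot_mehler {H K : (Fin n → ℝ) → ℝ} {C D : ℝ} (hH : BC H C) (hK : BC K D) {ρ : ℝ}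
    (h : ρ ∈ Set.Ioo (-(3 / 4) : ℝ) (3 / 4)) :
    mehler H K ρ = ∫ a, K a * ∫ b, H (ρ • a + (-√(1 - ρ ^ 2)) • b) ∂(gaussianPi n)
      ∂(gaussianPi n) := by
  set c := √(1 - ρ ^ 2) with hc
  have hc2 : c ^ 2 = 1 - ρ ^ 2 := Real.sq_sqrt (by nlinarith [h.1, h.2])
  have cont3 : Continuous (fun p : (Fin n → ℝ) × (Fin n → ℝ) =>
      H p.1 * K (ρ • p.1 + c • p.2)) :=
    (hH.1.comp (by fun_prop)).mul (hK.1.comp (by fun_prop))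
  rw [mehler, rot_integral (s := ρ) (r := -c) (by rw [neg_sq]; linarith) cont3]
  have e2 : ∀ p : (Fin n → ℝ) × (Fin n → ℝ),
      ρ • (ρ • p.1 + -c • p.2) + c • (- -c • p.1 + ρ • p.2) = p.1 := by
    intro p; ext i
    simp only [Pi.add_apply, Pi.smul_apply, smul_eq_mul]
    linear_combination (p.1 i) * hc2
  simp only [e2]
  have cont2 : Continuous (fun p : (Fin n → ℝ) × (Fin n → ℝ) =>
      H (ρ • p.1 + -c • p.2) * K p.1) :=
    (hH.1.comp (by fun_prop)).mul (hK.1.comp (by fun_prop))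
  rw [integral_prod _ (integrable_prod_bdd cont2 (C := C * D) fun p => by
    rw [abs_mul]; exact mul_le_mul (hH.2 _) (hK.2 _) (abs_nonneg _) hH.nonneg)]
  simp_rw [integral_mul_const, mul_comm]

lemma mehler_hasDerivAt {h k : (Fin n → ℝ) → ℝ} {C D : ℝ} (hh : Nice h C) (hk : Nice k D) {ρ : ℝ}
    (hρ : ρ ∈ Set.Ioo (-(3 / 4) : ℝ) (3 / 4)) :
    HasDerivAt (mehler h k) (∑ j, mehler (pderiv h j) (pderiv k j) ρ) ρ := by
  have hC := hh.bc.nonneg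
  have hD := hk.bc.nonneg
  let F : ℝ → (Fin n → ℝ) × (Fin n → ℝ) → ℝ := fun ρ p => h p.1 * k (ρ • p.1 + √(1 - ρ ^ 2) • p.2)
  let F' : ℝ → (Fin n → ℝ) × (Fin n → ℝ) → ℝ := fun ρ p =>
    h p.1 * ∑ j, pderiv k j (ρ • p.1 + √(1 - ρ ^ 2) • p.2) * (p.1 j + (-ρ / √(1 - ρ ^ 2)) * p.2 j)
  have cF : ∀ ρ, Continuous (F ρ) := fun ρ =>
    (hh.1.continuous.comp (by fun_prop)).mul (hk.1.continuous.comp (by fun_prop))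
  have cF' : ∀ ρ, Continuous (F' ρ) := fun ρ =>
    (hh.1.continuous.comp (by fun_prop)).mul (continuous_finset_sum _ fun j _ =>
      ((hk.bc_pderiv j).1.comp (by fun_prop)).mul (by fun_prop))
  have iF : Integrable (F ρ) ((gaussianPi n).prod (gaussianPi n)) :=
    integrable_prod_bdd (cF ρ) (C := C * D) fun p => by
      rw [abs_mul]; exact mul_le_mul (hh.2.1 _) (hk.2.1 _) (abs_nonneg _) hC
  let bound : (Fin n → ℝ) × (Fin n → ℝ) → ℝ := fun p => C * ∑ j, D * (|p.1 j| + 2 * |p.2 j|)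
  have ib : Integrable bound ((gaussianPi n).prod (gaussianPi n)) := by
    refine Integrable.const_mul (integrable_finsetSum _ fun j _ => ?_) _
    exact ((integrable_coord_fst j).add ((integrable_coord_snd j).const_mul 2)).const_mul D
  have hb : ∀ p, ∀ t ∈ Set.Ioo (-(3 / 4) : ℝ) (3 / 4), ‖F' t p‖ ≤ bound p := by
    intro p t ht
    simp only [F', bound, norm_mul, Real.norm_eq_abs]
    refine mul_le_mul (hh.2.1 _) ?_ (abs_nonneg _) hC
    refine (Finset.abs_sum_le_sum_abs _ _).trans (Finset.sum_le_sum fun j _ => ?_)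
    rw [abs_mul]
    refine mul_le_mul (hk.2.2 j _) ?_ (abs_nonneg _) hD
    refine (abs_add_le _ _).trans ?_
    rw [abs_mul]
    have h1 : |(-t / √(1 - t ^ 2))| ≤ 2 := by
      have := sqrt_ge_half ht
      rw [abs_div, abs_of_pos (a := √(1 - t ^ 2)) (by linarith), div_le_iff₀ (by linarith), abs_neg]
      have : |t| ≤ 1 := abs_le.2 ⟨by linarith [ht.1], by linarith [ht.2]⟩
      linarith
    have := mul_le_mul_of_nonneg_right h1 (abs_nonneg (p.2 j))
    linarith
  have hd : ∀ p, ∀ t ∈ Set.Ioo (-(3 / 4) : ℝ) (3 / 4), HasDerivAt (fun t => F t p) (F' t p) t := by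
    intro p t ht
    refine HasDerivAt.const_mul (h p.1) ?_
    have h1 := (hk.1.differentiable one_ne_zero (t • p.1 + √(1 - t ^ 2) • p.2)).hasFDerivAt
    have h2 : HasDerivAt (fun t : ℝ => t • p.1 + √(1 - t ^ 2) • p.2)
        ((1 : ℝ) • p.1 + (-t / √(1 - t ^ 2)) • p.2) t :=
      ((hasDerivAt_id t).smul_const _).add ((sqrt_hasDerivAt ht).smul_const _)
    have h3 := h1.comp_hasDerivAt t h2
    rw [fderiv_eq_sum] at h3
    refine h3.congr_deriv (Finset.sum_congr rfl fun j _ => ?_)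
    simp
  have hmain := hasDerivAt_integral_of_dominated_loc_of_deriv_le
    (μ := (gaussianPi n).prod (gaussianPi n)) (F := F) (F' := F') (x₀ := ρ)
    (s := Set.Ioo (-(3 / 4) : ℝ) (3 / 4)) (bound := bound) (Ioo_mem_nhds hρ.1 hρ.2)
    (Eventually.of_forall fun t => (cF t).aestronglyMeasurable) iF (cF' ρ).aestronglyMeasurable
    (ae_of_all _ hb) ib (ae_of_all _ hd)
  refine HasDerivAt.congr_deriv hmain.2 ?_
  set c := √(1 - ρ ^ 2) with hc
  have hc2 : c ^ 2 = 1 - ρ ^ 2 := Real.sq_sqrt (by nlinarith [hρ.1, hρ.2])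
  have hcpos : 0 < c := by have := sqrt_ge_half hρ; linarith
  rw [rot_integral (s := ρ) (r := -c) (by rw [neg_sq]; linarith) (cF' ρ)]
  have e2 : ∀ p : (Fin n → ℝ) × (Fin n → ℝ),
      ρ • (ρ • p.1 + -c • p.2) + c • (- -c • p.1 + ρ • p.2) = p.1 := by
    intro p; ext i
    simp only [Pi.add_apply, Pi.smul_apply, smul_eq_mul]
    linear_combination (p.1 i) * hc2
  have e3 : ∀ p : (Fin n → ℝ) × (Fin n → ℝ),
      F' ρ (ρ • p.1 + -c • p.2, - -c • p.1 + ρ • p.2) =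
        ∑ j, (-(1 / c)) * (pderiv k j p.1 * (h (ρ • p.1 + (-c) • p.2) * p.2 j)) := by
    intro p
    simp only [F', ← hc, e2]
    rw [Finset.mul_sum]
    refine Finset.sum_congr rfl fun j _ => ?_
    have : (ρ • p.1 + -c • p.2) j + -ρ / c * (- -c • p.1 + ρ • p.2) j = -(1 / c) * p.2 j := by
      simp only [Pi.add_apply, Pi.smul_apply, smul_eq_mul]
      field_simp
      linear_combination (-p.2 j) * hc2
    rw [this]; ring
  simp_rw [e3]
  have ij : ∀ j, Integrable (fun p : (Fin n → ℝ) × (Fin n → ℝ) =>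
      pderiv k j p.1 * (h (ρ • p.1 + (-c) • p.2) * p.2 j))
      ((gaussianPi n).prod (gaussianPi n)) := fun j => by
    have cc : Continuous (fun p : (Fin n → ℝ) × (Fin n → ℝ) =>
      pderiv k j p.1 * (h (ρ • p.1 + (-c) • p.2) * p.2 j)) :=
      ((hk.bc_pderiv j).1.comp (by fun_prop)).mul
        ((hh.1.continuous.comp (by fun_prop)).mul (by fun_prop))
    refine ((integrable_coord_snd (n := n) j).const_mul (D * C)).mono' cc.aestronglyMeasurable
      (ae_of_all _ fun p => ?_)
    rw [norm_mul, norm_mul, mul_assoc]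
    refine mul_le_mul (hk.2.2 j _) ?_ (by positivity) hD
    exact mul_le_mul_of_nonneg_right (hh.2.1 _) (abs_nonneg _)
  rw [integral_finsetSum _ fun j _ => (ij j).const_mul _]
  refine Finset.sum_congr rfl fun j _ => ?_
  rw [integral_const_mul, integral_prod _ (ij j), rot_mehler (hh.bc_pderiv j) (hk.bc_pderiv j) hρ,
    ← integral_const_mul]
  refine integral_congr_ae (ae_of_all _ fun a => ?_)
  simp only [integral_const_mul]
  rw [hh.ibp_affine (ρ • a) (-c) j]
  field_simp
  rw [← hc]

end interp

section dprime
variable {n : ℕ}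

lemma sq_integral_le {h : (Fin n → ℝ) → ℝ} {C : ℝ} (hh : BC h C) :
    (∫ z, h z ∂(gaussianPi n)) ^ 2 ≤ ∫ z, h z ^ 2 ∂(gaussianPi n) := by
  set m := ∫ z, h z ∂(gaussianPi n) with hm
  have i2 : Integrable (fun z => h z ^ 2) (gaussianPi n) := by
    simpa [sq] using (hh.mul hh).integrable
  have key : 0 ≤ ∫ z, (h z - m) ^ 2 ∂(gaussianPi n) := integral_nonneg fun z => sq_nonneg _
  have e : ∀ z, (h z - m) ^ 2 = h z ^ 2 - (2 * m * h z - m ^ 2) := fun z => by ring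
  simp_rw [e] at key
  have i3 : Integrable (fun z => 2 * m * h z - m ^ 2) (gaussianPi n) :=
    (hh.integrable.const_mul _).sub (integrable_const _)
  rw [integral_sub i2 i3, integral_sub (hh.integrable.const_mul _) (integrable_const _),
    integral_const_mul] at key
  simp only [integral_const, probReal_univ, one_smul, ← hm] at key
  nlinarith

lemma sum_sq_le_one {u : Fin n → (Fin n → ℝ) → ℝ} (hu : ∀ i, BC (u i) 1)
    (hs : ∀ x, ∑ i, u i x ^ 2 ≤ 1) : ∑ i, ∫ z, u i z ^ 2 ∂(gaussianPi n) ≤ 1 := by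
  have i2 : ∀ i, Integrable (fun z => u i z ^ 2) (gaussianPi n) := fun i => by
    simpa [sq] using ((hu i).mul (hu i)).integrable
  rw [← integral_finsetSum _ fun i _ => i2 i]
  have := integral_mono (integrable_finsetSum _ fun i _ => i2 i)
    (integrable_const (μ := gaussianPi n) (1 : ℝ)) hs
  simpa using this

lemma pointwise_bound {u v : Fin n → (Fin n → ℝ) → ℝ} (hu : ∀ i, BC (u i) 1)
    (hv : ∀ i, BC (v i) 1) (hu0 : ∀ i x, 0 ≤ u i x) (hv0 : ∀ i x, 0 ≤ v i x)
    (hus : ∀ x, ∑ i, u i x ^ 2 ≤ 1) (hvs : ∀ x, ∑ i, v i x ^ 2 ≤ 1) {l : ℝ} (hl : 1 ≤ l) :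
    -∑ i, ∑ j, (∫ z, u i z * z j ∂(gaussianPi n)) * (∫ z, v i z * z j ∂(gaussianPi n)) ≤
      4 * l ^ 2 * ∑ i, (∫ z, u i z ∂(gaussianPi n)) * (∫ z, v i z ∂(gaussianPi n)) +
        5 * l * Real.exp (-l ^ 2) := by
  set ε := Real.exp (-l ^ 2) with hε
  have hε0 : 0 < ε := Real.exp_pos _
  have hε1 : ε ≤ 1 := Real.exp_le_one_iff.2 (by nlinarith)
  have per : ∀ i, -∑ j, (∫ z, u i z * z j ∂(gaussianPi n)) * (∫ z, v i z * z j ∂(gaussianPi n)) ≤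
      4 * l ^ 2 * ((∫ z, u i z ∂(gaussianPi n)) * (∫ z, v i z ∂(gaussianPi n))) +
        5 * l * ε * ((∫ z, u i z ^ 2 ∂(gaussianPi n) + ∫ z, v i z ^ 2 ∂(gaussianPi n)) / 2) := by
    intro i
    have h1 := vec_lam (hu i) (hu0 i) hl
    have h2 := vec_lam (hv i) (hv0 i) hl
    have h3 := Real.sum_mul_le_sqrt_mul_sqrt Finset.univ
      (fun j => -∫ z, u i z * z j ∂(gaussianPi n)) (fun j => ∫ z, v i z * z j ∂(gaussianPi n))
    simp only [neg_mul, Finset.sum_neg_distrib, neg_sq] at h3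
    have hu1 : 0 ≤ ∫ z, u i z ∂(gaussianPi n) := integral_nonneg (hu0 i)
    have hv1 : 0 ≤ ∫ z, v i z ∂(gaussianPi n) := integral_nonneg (hv0 i)
    have hu2 : 0 ≤ ∫ z, u i z ^ 2 ∂(gaussianPi n) := integral_nonneg fun z => sq_nonneg _
    have hv2 : 0 ≤ ∫ z, v i z ^ 2 ∂(gaussianPi n) := integral_nonneg fun z => sq_nonneg _
    have hu3 := Real.le_sqrt_of_sq_le (sq_integral_le (hu i))
    have hv3 := Real.le_sqrt_of_sq_le (sq_integral_le (hv i))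
    have hA := Real.sq_sqrt hu2
    have hB := Real.sq_sqrt hv2
    have hA0 := Real.sqrt_nonneg (∫ z, u i z ^ 2 ∂(gaussianPi n))
    have hB0 := Real.sqrt_nonneg (∫ z, v i z ^ 2 ∂(gaussianPi n))
    rw [← hε] at h1 h2
    have h4 := h3.trans (mul_le_mul h1 h2 (Real.sqrt_nonneg _) (by positivity))
    refine h4.trans ?_
    rw [← hA, ← hB]
    generalize √(∫ z, u i z ^ 2 ∂(gaussianPi n)) = A at *
    generalize √(∫ z, v i z ^ 2 ∂(gaussianPi n)) = B at *
    generalize (∫ z, u i z ∂(gaussianPi n)) = a at *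
    generalize (∫ z, v i z ∂(gaussianPi n)) = b at *
    rw [Real.sqrt_sq hA0, Real.sqrt_sq hB0]
    have hle : 0 ≤ l * ε := by positivity
    have t1 : a * B ≤ A * B := mul_le_mul_of_nonneg_right hu3 hB0
    have t2 : A * b ≤ A * B := mul_le_mul_of_nonneg_left hv3 hA0
    have t3 : ε * ε ≤ l * ε := mul_le_mul_of_nonneg_right (hε1.trans hl) hε0.le
    have t4 : 0 ≤ A * B := mul_nonneg hA0 hB0
    have t5 : A * B ≤ (A ^ 2 + B ^ 2) / 2 := by nlinarith [sq_nonneg (A - B)]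
    calc (2 * l * a + ε * A) * (2 * l * b + ε * B)
        = 4 * l ^ 2 * (a * b) + 2 * (l * ε) * (a * B + A * b) + ε * ε * (A * B) := by ring
      _ ≤ 4 * l ^ 2 * (a * b) + 2 * (l * ε) * (A * B + A * B) + l * ε * (A * B) := by gcongr
      _ = 4 * l ^ 2 * (a * b) + 5 * l * ε * (A * B) := by ring
      _ ≤ 4 * l ^ 2 * (a * b) + 5 * l * ε * ((A ^ 2 + B ^ 2) / 2) := by gcongr
  have hs := Finset.sum_le_sum fun i (_ : i ∈ Finset.univ) => per i
  rw [Finset.sum_neg_distrib, Finset.sum_add_distrib, ← Finset.mul_sum, ← Finset.mul_sum,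
    ← Finset.sum_div, Finset.sum_add_distrib] at hs
  refine hs.trans ?_
  have s1 := sum_sq_le_one hu hus
  have s2 := sum_sq_le_one hv hvs
  have : 0 ≤ 5 * l * ε := by positivity
  nlinarith

lemma dprime_bound {U V : Fin n → (Fin n → ℝ) → ℝ} (hU : ∀ i, Nice (U i) 1)
    (hV : ∀ i, Nice (V i) 1) (hU0 : ∀ i x, 0 ≤ U i x) (hV0 : ∀ i x, 0 ≤ V i x)
    (hUs : ∀ x, ∑ i, U i x ^ 2 ≤ 1) (hVs : ∀ x, ∑ i, V i x ^ 2 ≤ 1) {l : ℝ} (hl : 1 ≤ l) {ρ : ℝ}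
    (h0 : 0 ≤ ρ) (h1 : ρ ≤ 1 / 2) :
    -(8 * l ^ 2 * (∑ i, mehler (U i) (V i) ρ) + 10 * l * Real.exp (-l ^ 2)) ≤
      ∑ i, ∑ j, mehler (pderiv (U i) j) (pderiv (V i) j) ρ := by
  have h1' : ρ < 1 := by linarith
  have z1 : ∀ i, mehler (U i) (V i) ρ = _ := fun i => zrep (hU i).bc (hV i).bc h0 h1'
  have z2 : ∀ i j, mehler (pderiv (U i) j) (pderiv (V i) j) ρ = _ := fun i j =>
    zrep ((hU i).bc_pderiv j) ((hV i).bc_pderiv j) h0 h1'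
  simp_rw [z1, z2]
  set c := √(1 - ρ) with hc
  have hc2 : c ^ 2 = 1 - ρ := Real.sq_sqrt (by linarith)
  have i1 : ∀ i, Integrable (fun z => (∫ x, U i (√ρ • z + c • x) ∂(gaussianPi n)) *
      (∫ y, V i (√ρ • z + c • y) ∂(gaussianPi n))) (gaussianPi n) := fun i =>
    ((bc_avg (hU i).bc _ _).mul (bc_avg (hV i).bc _ _)).integrable
  have i2 : ∀ i j, Integrable (fun z => (∫ x, pderiv (U i) j (√ρ • z + c • x) ∂(gaussianPi n)) *
      (∫ y, pderiv (V i) j (√ρ • z + c • y) ∂(gaussianPi n))) (gaussianPi n) := fun i j =>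
    ((bc_avg ((hU i).bc_pderiv j) _ _).mul (bc_avg ((hV i).bc_pderiv j) _ _)).integrable
  have i2' : ∀ i, Integrable (fun z => ∑ j,
      (∫ x, pderiv (U i) j (√ρ • z + c • x) ∂(gaussianPi n)) *
      (∫ y, pderiv (V i) j (√ρ • z + c • y) ∂(gaussianPi n))) (gaussianPi n) := fun i =>
    integrable_finsetSum _ fun j _ => i2 i j
  rw [← integral_finsetSum _ fun i _ => i1 i]
  simp_rw [← integral_finsetSum _ fun j _ => i2 _ j]
  rw [← integral_finsetSum _ fun i _ => i2' i]
  have key : ∀ z : Fin n → ℝ, -(8 * l ^ 2 * ∑ i, (∫ x, U i (√ρ • z + c • x) ∂(gaussianPi n)) *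
      (∫ y, V i (√ρ • z + c • y) ∂(gaussianPi n)) + 10 * l * Real.exp (-l ^ 2)) ≤
      ∑ i, ∑ j, (∫ x, pderiv (U i) j (√ρ • z + c • x) ∂(gaussianPi n)) *
      (∫ y, pderiv (V i) j (√ρ • z + c • y) ∂(gaussianPi n)) := by
    intro z
    have pb := pointwise_bound (u := fun i x => U i (√ρ • z + c • x))
      (v := fun i x => V i (√ρ • z + c • x)) (fun i => (hU i).bc.comp (by fun_prop))
      (fun i => (hV i).bc.comp (by fun_prop)) (fun i x => hU0 i _) (fun i x => hV0 i _)
      (fun x => hUs _) (fun x => hVs _) hl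
    simp_rw [(hU _).ibp_affine, (hV _).ibp_affine] at pb
    have e : ∀ i j, (c * ∫ x, pderiv (U i) j (√ρ • z + c • x) ∂(gaussianPi n)) *
        (c * ∫ x, pderiv (V i) j (√ρ • z + c • x) ∂(gaussianPi n)) =
        c ^ 2 * ((∫ x, pderiv (U i) j (√ρ • z + c • x) ∂(gaussianPi n)) *
        (∫ x, pderiv (V i) j (√ρ • z + c • x) ∂(gaussianPi n))) := fun i j => by ring
    simp_rw [e, ← Finset.mul_sum] at pb
    have pos : 0 ≤ ∑ i, (∫ x, U i (√ρ • z + c • x) ∂(gaussianPi n)) *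
        (∫ y, V i (√ρ • z + c • y) ∂(gaussianPi n)) := Finset.sum_nonneg fun i _ =>
      mul_nonneg (integral_nonneg fun x => hU0 i _) (integral_nonneg fun x => hV0 i _)
    have pos2 : 0 ≤ 4 * l ^ 2 * ∑ i, (∫ x, U i (√ρ • z + c • x) ∂(gaussianPi n)) *
        (∫ y, V i (√ρ • z + c • y) ∂(gaussianPi n)) + 5 * l * Real.exp (-l ^ 2) := by positivity
    generalize (∑ i, ∑ j, (∫ x, pderiv (U i) j (√ρ • z + c • x) ∂(gaussianPi n)) *
      (∫ y, pderiv (V i) j (√ρ • z + c • y) ∂(gaussianPi n))) = S at *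
    rw [hc2] at pb
    by_cases hS : 0 ≤ S
    · linarith
    · push Not at hS
      nlinarith
  have hI : Integrable (fun z => ∑ i, (∫ x, U i (√ρ • z + c • x) ∂(gaussianPi n)) *
      (∫ y, V i (√ρ • z + c • y) ∂(gaussianPi n))) (gaussianPi n) :=
    integrable_finsetSum _ fun i _ => i1 i
  have hI2 : Integrable (fun z => 8 * l ^ 2 * (∑ i, (∫ x, U i (√ρ • z + c • x) ∂(gaussianPi n)) *
      (∫ y, V i (√ρ • z + c • y) ∂(gaussianPi n))) + 10 * l * Real.exp (-l ^ 2))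
      (gaussianPi n) := (hI.const_mul _).add (integrable_const _)
  have fin := integral_mono hI2.neg (integrable_finsetSum _ fun i _ => i2' i) key
  refine le_trans (le_of_eq ?_) fin
  simp only [Pi.neg_apply]
  rw [integral_neg, integral_add (hI.const_mul _) (integrable_const _), integral_const_mul]
  simp

end dprime

section final

lemma gronwall_aux {ψ D D' : ℝ → ℝ} {K ε : ℝ} (hK : 2 ≤ K)
    (hψ : ∀ ρ ∈ Set.Icc (0 : ℝ) (1 / 2), HasDerivAt ψ (D ρ) ρ)
    (hD : ∀ ρ ∈ Set.Icc (0 : ℝ) (1 / 2), HasDerivAt D (D' ρ) ρ)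
    (hD' : ∀ ρ ∈ Set.Icc (0 : ℝ) (1 / 2), -(K * D ρ + ε) ≤ D' ρ) (hε : 0 ≤ ε) (h0 : 0 ≤ D 0) :
    (1 / K) * (D 0 * Real.exp (-1) - ε / K) ≤ ψ (1 / K) - ψ 0 := by
  have hK0 : 0 < K := by linarith
  have hKi : 1 / K ≤ 1 / 2 := one_div_le_one_div_of_le two_pos hK
  have hKp : 0 < 1 / K := by positivity
  have sub : ∀ ρ ∈ Set.Icc (0 : ℝ) (1 / K), ρ ∈ Set.Icc (0 : ℝ) (1 / 2) := fun ρ h =>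
    ⟨h.1, h.2.trans hKi⟩
  have hw : ∀ ρ ∈ Set.Icc (0 : ℝ) (1 / K),
      HasDerivAt (fun ρ => (D ρ + ε / K) * Real.exp (K * ρ))
        (D' ρ * Real.exp (K * ρ) + (D ρ + ε / K) * (Real.exp (K * ρ) * K)) ρ := by
    intro ρ hρ
    have h1 := (hD ρ (sub ρ hρ)).add_const (ε / K)
    have h2 : HasDerivAt (fun ρ => K * ρ) K ρ := by simpa using (hasDerivAt_id ρ).const_mul K
    exact h1.mul h2.exp
  have m1 : MonotoneOn (fun ρ => (D ρ + ε / K) * Real.exp (K * ρ)) (Set.Icc 0 (1 / K)) := by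
    refine monotoneOn_of_deriv_nonneg (convex_Icc _ _)
      (fun ρ hρ => (hw ρ hρ).continuousAt.continuousWithinAt)
      (fun ρ hρ => (hw ρ (interior_subset hρ)).differentiableAt.differentiableWithinAt) ?_
    intro ρ hρ
    rw [(hw ρ (interior_subset hρ)).deriv]
    have h1 := hD' ρ (sub ρ (interior_subset hρ))
    have e : D' ρ * Real.exp (K * ρ) + (D ρ + ε / K) * (Real.exp (K * ρ) * K) =
        (D' ρ + (K * D ρ + ε)) * Real.exp (K * ρ) := by field_simp
    rw [e]
    exact mul_nonneg (by linarith) (Real.exp_pos _).le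
  have low : ∀ ρ ∈ Set.Icc (0 : ℝ) (1 / K), D 0 * Real.exp (-1) - ε / K ≤ D ρ := by
    intro ρ hρ
    have h1 := m1 (Set.left_mem_Icc.2 hKp.le) hρ hρ.1
    simp only [mul_zero, Real.exp_zero, mul_one] at h1
    have hKρ : K * ρ ≤ 1 := by
      have := mul_le_mul_of_nonneg_left hρ.2 hK0.le
      rwa [mul_one_div_cancel hK0.ne'] at this
    have h2 : Real.exp (-1) ≤ Real.exp (-(K * ρ)) := Real.exp_le_exp.2 (by linarith)
    have h3 : (D 0 + ε / K) * Real.exp (-(K * ρ)) ≤ D ρ + ε / K := by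
      have := mul_le_mul_of_nonneg_right h1 (Real.exp_pos (-(K * ρ))).le
      rwa [mul_assoc, ← Real.exp_add, add_neg_cancel, Real.exp_zero, mul_one] at this
    have h4 : 0 ≤ ε / K := by positivity
    have h5 : D 0 * Real.exp (-1) ≤ (D 0 + ε / K) * Real.exp (-(K * ρ)) :=
      mul_le_mul (by linarith) h2 (Real.exp_pos _).le (by linarith)
    linarith
  set m := D 0 * Real.exp (-1) - ε / K
  have hv : ∀ ρ ∈ Set.Icc (0 : ℝ) (1 / K), HasDerivAt (fun ρ => ψ ρ - m * ρ) (D ρ - m) ρ := by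
    intro ρ hρ
    have h2 : HasDerivAt (fun ρ => m * ρ) m ρ := by simpa using (hasDerivAt_id ρ).const_mul m
    exact (hψ ρ (sub ρ hρ)).sub h2
  have m2 : MonotoneOn (fun ρ => ψ ρ - m * ρ) (Set.Icc 0 (1 / K)) := by
    refine monotoneOn_of_deriv_nonneg (convex_Icc _ _)
      (fun ρ hρ => (hv ρ hρ).continuousAt.continuousWithinAt)
      (fun ρ hρ => (hv ρ (interior_subset hρ)).differentiableAt.differentiableWithinAt) ?_
    intro ρ hρ
    rw [(hv ρ (interior_subset hρ)).deriv]
    linarith [low ρ (interior_subset hρ)]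
  have := m2 (Set.left_mem_Icc.2 hKp.le) (Set.right_mem_Icc.2 hKp.le) hKp.le
  simp only [mul_zero, sub_zero] at this
  linarith

lemma numeric_aux {W D0 gain : ℝ} (hW : 0 < W) (hW1 : W ≤ 1) (hD : W / 4 ≤ D0)
    (hg : ∀ l : ℝ, 1 ≤ l → (1 / (8 * l ^ 2)) *
      (D0 * Real.exp (-1) - (10 * l * Real.exp (-l ^ 2)) / (8 * l ^ 2)) ≤ gain) :
    1 / 800 * (W / Real.log (Real.exp 1 / W)) ≤ gain := by
  set L := Real.log (Real.exp 1 / W) with hL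
  have hLe : L = 1 - Real.log W := by
    rw [hL, Real.log_div (Real.exp_pos 1).ne' hW.ne', Real.log_exp]
  have hL1 : 1 ≤ L := by
    have := Real.log_nonpos hW.le hW1
    linarith
  have hl2 : √(4 + L) ^ 2 = 4 + L := Real.sq_sqrt (by linarith)
  have hl1 : 1 ≤ √(4 + L) := Real.le_sqrt_of_sq_le (by linarith)
  have h := hg _ hl1
  set l := √(4 + L) with hl
  have hexp : Real.exp (-l ^ 2) = W * Real.exp (-5) := by
    rw [hl2, hLe]
    have : -(4 + (1 - Real.log W)) = Real.log W + (-5) := by ring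
    rw [this, Real.exp_add, Real.exp_log hW]
  have e1 : (0.36 : ℝ) ≤ Real.exp (-1) := by
    rw [Real.exp_neg, le_inv_comm₀ (by norm_num) (Real.exp_pos 1)]
    have := Real.exp_one_lt_d9
    norm_num at this ⊢
    linarith
  have e2 : Real.exp (-5) ≤ 0.02 := by
    have h5 : Real.exp (-5) = Real.exp (-1) ^ 5 := by
      rw [← Real.exp_nat_mul]; norm_num
    have h6 : Real.exp (-1) ≤ 0.4 := by
      rw [Real.exp_neg, inv_le_comm₀ (Real.exp_pos 1) (by norm_num)]
      have := Real.exp_one_gt_d9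
      norm_num at this ⊢
      linarith
    rw [h5]
    calc Real.exp (-1) ^ 5 ≤ 0.4 ^ 5 := by gcongr
      _ ≤ 0.02 := by norm_num
  have hl0 : 0 < l := by linarith
  have b1 : (10 * l * Real.exp (-l ^ 2)) / (8 * l ^ 2) ≤ 0.025 * W := by
    rw [hexp, div_le_iff₀ (by positivity)]
    have t1 : W * Real.exp (-5) ≤ W * 0.02 := by gcongr
    have t2 : l ≤ l ^ 2 := by nlinarith
    calc 10 * l * (W * Real.exp (-5)) ≤ 10 * l ^ 2 * (W * 0.02) := by gcongr
      _ = 0.025 * W * (8 * l ^ 2) := by ring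
  have b2 : 0.09 * W ≤ D0 * Real.exp (-1) := by
    calc 0.09 * W = W / 4 * 0.36 := by ring
      _ ≤ D0 * Real.exp (-1) := mul_le_mul hD e1 (by norm_num) (by linarith)
  refine le_trans ?_ h
  have b3 : W / 20 ≤ D0 * Real.exp (-1) - (10 * l * Real.exp (-l ^ 2)) / (8 * l ^ 2) := by
    linarith
  have b4 : 1 / (40 * L) ≤ 1 / (8 * l ^ 2) :=
    one_div_le_one_div_of_le (by positivity) (by rw [hl2]; linarith)
  calc 1 / 800 * (W / L) = 1 / (40 * L) * (W / 20) := by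
        have : L ≠ 0 := by linarith
        field_simp; norm_num
    _ ≤ _ := mul_le_mul b4 b3 (by positivity) (by positivity)

lemma U_mean {n : ℕ} {f : (Fin n → ℝ) → ℝ} (hf : BC f 1) (i : Fin n) :
    ∫ x, pderiv (smT (smT f)) i x ∂(gaussianPi n) = 1 / 2 * ∫ x, f x * x i ∂(gaussianPi n) := by
  rw [← (smT_nice (smT_nice hf).bc).ibp i, smT_coord (smT_nice hf).bc, smT_coord hf, ← mul_assoc,
    ← sq, qq_sq]

lemma mehler_le {n : ℕ} {f g : (Fin n → ℝ) → ℝ} (hf : BC f 1) (hg : BC g 1) (hfm : Monotone f)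
    (hgm : Monotone g) {ρ : ℝ} (h0 : 0 ≤ ρ) (h1 : ρ < 1) :
    mehler (smT (smT f)) (smT (smT g)) ρ ≤ ∫ x, f x * g x ∂(gaussianPi n) := by
  have f1 := (smT_nice hf).bc
  have g1 := (smT_nice hg).bc
  have hq : qq ^ 2 + qq ^ 2 = 1 := by rw [qq_sq]; norm_num
  rw [zrep (smT_nice f1).bc (smT_nice g1).bc h0 h1]
  refine (harris_avg (smT_nice f1).bc (smT_nice g1).bc (smT_mono f1 (smT_mono hf hfm))
    (smT_mono g1 (smT_mono hg hgm)) (by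
      rw [Real.sq_sqrt h0, Real.sq_sqrt (by linarith)]; ring) (Real.sqrt_nonneg _)).trans ?_
  have a1 := harris_avg f1 g1 (smT_mono hf hfm) (smT_mono hg hgm) hq qq_nonneg
  have a2 := harris_avg hf hg hfm hgm hq qq_nonneg
  simp_rw [← smT_eq] at a1 a2
  exact a1.trans a2

lemma main_bound {n : ℕ} {f g : (Fin n → ℝ) → ℝ} (hfc : ContDiff ℝ 1 f) (hgc : ContDiff ℝ 1 g)
    (hfm : Monotone f) (hgm : Monotone g) (hfb : ∀ x, |f x| ≤ 1) (hgb : ∀ x, |g x| ≤ 1) {W : ℝ}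
    (hWdef : W = ∑ i, (∫ x, pderiv f i x ∂(gaussianPi n)) * (∫ x, pderiv g i x ∂(gaussianPi n))) :
    1 / 800 * (W / Real.log (Real.exp 1 / W)) ≤ (∫ x, f x * g x ∂(gaussianPi n)) -
      (∫ x, f x ∂(gaussianPi n)) * (∫ x, g x ∂(gaussianPi n)) := by
  have hf : BC f 1 := ⟨hfc.continuous, hfb⟩
  have hg : BC g 1 := ⟨hgc.continuous, hgb⟩
  have pf0 : ∀ i, 0 ≤ ∫ x, pderiv f i x ∂(gaussianPi n) := fun i =>
    integral_nonneg (pderiv_nonneg hfm hfc i)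
  have pg0 : ∀ i, 0 ≤ ∫ x, pderiv g i x ∂(gaussianPi n) := fun i =>
    integral_nonneg (pderiv_nonneg hgm hgc i)
  have pf1 := integral_pderiv_le hfm hfc hfb
  have pg1 := integral_pderiv_le hgm hgc hgb
  have hW0 : 0 ≤ W := by
    rw [hWdef]; exact Finset.sum_nonneg fun i _ => mul_nonneg (pf0 i) (pg0 i)
  rcases hW0.eq_or_lt with hW | hW
  · rw [← hW]
    have := harris n f g 1 hf.1.measurable hg.1.measurable hfm hgm hfb hgb
    simp only [zero_div, mul_zero]
    linarith
  have hWle : W ≤ ∑ i, (∫ x, f x * x i ∂(gaussianPi n)) * (∫ x, g x * x i ∂(gaussianPi n)) := by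
    rw [hWdef]
    exact Finset.sum_le_sum fun i _ => mul_le_mul (pf1 i) (pg1 i) (pg0 i) ((pf0 i).trans (pf1 i))
  have hW1 : W ≤ 1 := by
    have b1 := bessel hf
    have b2 := bessel hg
    have : ∑ i, (∫ x, f x * x i ∂(gaussianPi n)) * (∫ x, g x * x i ∂(gaussianPi n)) ≤
        ∑ i, ((∫ x, f x * x i ∂(gaussianPi n)) ^ 2 + (∫ x, g x * x i ∂(gaussianPi n)) ^ 2) / 2 :=
      Finset.sum_le_sum fun i _ => by
        nlinarith [sq_nonneg ((∫ x, f x * x i ∂(gaussianPi n)) - ∫ x, g x * x i ∂(gaussianPi n))]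
    rw [← Finset.sum_div, Finset.sum_add_distrib] at this
    linarith
  have f1 := smT_nice hf
  have g1 := smT_nice hg
  have f2 := smT_nice f1.bc
  have g2 := smT_nice g1.bc
  have fm2 := smT_mono f1.bc (smT_mono hf hfm)
  have gm2 := smT_mono g1.bc (smT_mono hg hgm)
  set F := smT (smT f) with hF
  set G := smT (smT g) with hG
  have hU : ∀ i, Nice (pderiv F i) 1 := smT_pderiv_nice f1
  have hV : ∀ i, Nice (pderiv G i) 1 := smT_pderiv_nice g1
  have hU0 : ∀ i x, 0 ≤ pderiv F i x := pderiv_nonneg fm2 f2.1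
  have hV0 : ∀ i x, 0 ≤ pderiv G i x := pderiv_nonneg gm2 g2.1
  have hUs : ∀ x, ∑ i, pderiv F i x ^ 2 ≤ 1 := fun x => by simpa using smT_bessel f1.bc x
  have hVs : ∀ x, ∑ i, pderiv G i x ^ 2 ≤ 1 := fun x => by simpa using smT_bessel g1.bc x
  have hD0 : W / 4 ≤ ∑ i, mehler (pderiv F i) (pderiv G i) 0 := by
    have : ∑ i, mehler (pderiv F i) (pderiv G i) 0 =
        (∑ i, (∫ x, f x * x i ∂(gaussianPi n)) * (∫ x, g x * x i ∂(gaussianPi n))) / 4 := by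
      rw [Finset.sum_div]
      refine Finset.sum_congr rfl fun i _ => ?_
      rw [mehler_zero (hU i).bc (hV i).bc, hF, hG, U_mean hf, U_mean hg]
      ring
    rw [this]; linarith
  have inI : ∀ ρ ∈ Set.Icc (0 : ℝ) (1 / 2), ρ ∈ Set.Ioo (-(3 / 4) : ℝ) (3 / 4) := fun ρ h =>
    ⟨by linarith [h.1], by linarith [h.2]⟩
  refine numeric_aux hW hW1 hD0 fun l hl => ?_
  have hl2 : 1 ≤ l ^ 2 := by nlinarith
  have gr := gronwall_aux (ψ := mehler F G) (D := fun ρ => ∑ i, mehler (pderiv F i) (pderiv G i) ρ)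
    (D' := fun ρ => ∑ i, ∑ j, mehler (pderiv (pderiv F i) j) (pderiv (pderiv G i) j) ρ)
    (K := 8 * l ^ 2) (ε := 10 * l * Real.exp (-l ^ 2)) (by linarith)
    (fun ρ hρ => mehler_hasDerivAt f2 g2 (inI ρ hρ))
    (fun ρ hρ => HasDerivAt.fun_sum fun i _ => mehler_hasDerivAt (hU i) (hV i) (inI ρ hρ))
    (fun ρ hρ => dprime_bound hU hV hU0 hV0 hUs hVs hl hρ.1 hρ.2) (by positivity)
    (by linarith)
  refine gr.trans ?_
  rw [mehler_zero f2.bc g2.bc, hF, hG, smT_integral f1.bc, smT_integral g1.bc, smT_integral hf,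
    smT_integral hg]
  refine sub_le_sub_right (mehler_le hf hg hfm hgm (by positivity) ?_) _
  rw [div_lt_one (by positivity)]; linarith

end final

/-- **Theorem (functional Gaussian Talagrand bound).**
There is a universal constant `c > 0` such that for every `n ≥ 1` and every pair of
increasing `C¹` functions `f, g : ℝⁿ → [−1,1]`,
`E_μ[fg] − E_μ[f]·E_μ[g] ≥ c·φ(∑ i, E_μ[∂_i f]·E_μ[∂_i g])` where `φ(x) = x / log(e/x)`. -/
theorem gaussian_talagrand_functional :
    ∃ c : ℝ, 0 < c ∧
      ∀ (n : ℕ), 1 ≤ n → ∀ (f g : (Fin n → ℝ) → ℝ),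
        ContDiff ℝ 1 f → ContDiff ℝ 1 g → Monotone f → Monotone g →
        (∀ x, f x ∈ Set.Icc (-1 : ℝ) 1) → (∀ x, g x ∈ Set.Icc (-1 : ℝ) 1) →
        (∫ x, f x * g x ∂(gaussianPi n)) -
            (∫ x, f x ∂(gaussianPi n)) * (∫ x, g x ∂(gaussianPi n)) ≥
          c * ((∑ i, (∫ x, pderiv f i x ∂(gaussianPi n)) *
                      (∫ x, pderiv g i x ∂(gaussianPi n))) /
            Real.log (Real.exp 1 / ∑ i, (∫ x, pderiv f i x ∂(gaussianPi n)) *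
                      (∫ x, pderiv g i x ∂(gaussianPi n)))) := by
  refine ⟨1 / 800, by norm_num, fun n _ f g hfc hgc hfm hgm hfb hgb => ?_⟩
  exact main_bound hfc hgc hfm hgm (fun x => abs_le.2 (hfb x)) (fun x => abs_le.2 (hgb x)) rfl
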